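/- arXiv:2504.07259 — 3 statements merged into one kernel-verified Lean document; each statement's English description precedes it below -/
import Mathlib

section
/- Let H be a real Hilbert space and let f, g : H → ℝ be convex functions of class C^{1,1}_loc (Fréchet differentiable with locally Lipschitz gradient). Assume (i) ‖∇f(x)‖ = ‖∇g(x)‖ for all x ∈ H, and (ii) p_f = p_g, where p_f (resp. p_g) is the Crandall–Pazy direction of f (resp. g). Then there exists a constant c ∈ ℝ such that f(x) = g(x) + c for all x ∈ H. -/
open Set Filter

open Topology Metric
open scoped NNReal RealInnerProductSpace

/-- A Brezis–Browder / Ekeland type variational principle: a bounded below continuous function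
admits a point that is maximal for the order
`z ≼ z' ↔ F z' + κ * dist z z' ≤ F z ∧ E z ≤ E z'`. -/
theorem exists_forall_eq_of_add_dist_le {X : Type*} [MetricSpace X] [CompleteSpace X]
    {F E : X → ℝ} (hF : Continuous F) (hE : Continuous E) {m : ℝ} (hm : ∀ x, m ≤ F x)
    {κ : ℝ} (hκ : 0 < κ) (x₀ : X) :
    ∃ z, E x₀ ≤ E z ∧ ∀ z', F z' + κ * dist z z' ≤ F z → E z ≤ E z' → z' = z := by
  let R : X → X → Prop := fun z z' => F z' + κ * dist z z' ≤ F z ∧ E z ≤ E z'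
  have hrefl : ∀ z, R z z := fun z => ⟨by simp, le_rfl⟩
  have htrans : ∀ x y z, R x y → R y z → R x z := by
    rintro x y z ⟨h1, h2⟩ ⟨h3, h4⟩
    refine ⟨?_, h2.trans h4⟩
    have := mul_le_mul_of_nonneg_left (dist_triangle x y z) hκ.le
    linarith
  have hstep : ∀ (n : ℕ) (x : X), ∃ y, R x y ∧ ∀ z, R x z → F y ≤ F z + (1 / 2 : ℝ) ^ n := by
    intro n x
    have hbdd : BddBelow (F '' {z | R x z}) := ⟨m, by rintro _ ⟨z, -, rfl⟩; exact hm z⟩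
    have hne : (F '' {z | R x z}).Nonempty := ⟨F x, x, hrefl x, rfl⟩
    obtain ⟨_, ⟨y, hy, rfl⟩, hlt⟩ := exists_lt_of_csInf_lt hne
      (lt_add_of_pos_right (sInf (F '' {z | R x z})) (by positivity : (0 : ℝ) < (1 / 2) ^ n))
    refine ⟨y, hy, fun z hz => ?_⟩
    have := csInf_le hbdd (mem_image_of_mem F hz)
    linarith
  choose next hnext hnextle using hstep
  let u : ℕ → X := fun n => Nat.rec x₀ (fun n x => next n x) n
  have hu : ∀ n, u (n + 1) = next n (u n) := fun n => rfl
  have hR : ∀ n k, R (u n) (u (n + k)) := by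
    intro n k
    induction k with
    | zero => exact hrefl _
    | succ k ih => exact htrans _ _ _ ih (hu (n + k) ▸ hnext _ _)
  have hclose : ∀ n z, R (u (n + 1)) z → κ * dist (u (n + 1)) z ≤ (1 / 2 : ℝ) ^ n := by
    intro n z hz
    have h1 := hnextle n (u n) z (htrans _ _ _ (hR n 1) hz)
    rw [← hu] at h1
    linarith [hz.1]
  have htend : Tendsto (fun n : ℕ => (1 / 2 : ℝ) ^ n / κ) atTop (𝓝 0) := by
    simpa using (tendsto_pow_atTop_nhds_zero_of_lt_one (by norm_num : (0 : ℝ) ≤ 1 / 2)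
      (by norm_num)).div_const κ
  have hcau : CauchySeq (fun n => u (n + 1)) := by
    refine cauchySeq_of_le_tendsto_0' _ (fun n k hnk => ?_) htend
    obtain ⟨j, rfl⟩ := Nat.exists_eq_add_of_le hnk
    rw [le_div_iff₀' hκ]
    exact hclose n _ (by simpa [add_right_comm] using hR (n + 1) j)
  obtain ⟨z, hz⟩ := cauchySeq_tendsto_of_complete hcau
  have hRz : ∀ n, R (u n) z := by
    intro n
    have hev : ∀ᶠ k in atTop, R (u n) (u (k + 1)) := by
      filter_upwards [eventually_ge_atTop n] with k hk
      obtain ⟨j, rfl⟩ := Nat.exists_eq_add_of_le hk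
      exact hR n (j + 1)
    refine ⟨le_of_tendsto (((hF.tendsto z).comp hz).add
      ((tendsto_const_nhds.dist hz).const_mul κ)) (hev.mono fun k hk => hk.1),
      ge_of_tendsto ((hE.tendsto z).comp hz) (hev.mono fun k hk => hk.2)⟩
  refine ⟨z, (hRz 0).2, fun z' h1 h2 => ?_⟩
  have hlim : Tendsto (fun n => u (n + 1)) atTop (𝓝 z') := by
    rw [tendsto_iff_dist_tendsto_zero]
    refine squeeze_zero (fun _ => dist_nonneg) (fun n => ?_) htend
    rw [le_div_iff₀' hκ]
    exact hclose n z' (htrans _ z _ (hRz (n + 1)) ⟨h1, h2⟩)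
  exact tendsto_nhds_unique hlim hz

/-- A locally Lipschitz autonomous vector field has solutions for a uniform positive time,
for all initial points near a given one. -/
theorem LocallyLipschitz.exists_hasDerivWithinAt_Icc {E : Type*} [NormedAddCommGroup E]
    [NormedSpace ℝ E] [CompleteSpace E] {v : E → E} (hv : LocallyLipschitz v) (x₀ : E) :
    ∃ ε > 0, ∃ r > 0, ∀ x ∈ closedBall x₀ r, ∃ α : ℝ → E, α 0 = x ∧
      ∀ t ∈ Icc 0 ε, HasDerivWithinAt α (v (α t)) (Icc 0 ε) t := by
  obtain ⟨K, s, hs, hl⟩ := hv x₀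
  obtain ⟨a, ha, has⟩ := Metric.nhds_basis_closedBall.mem_iff.mp hs
  lift a to ℝ≥0 using ha.le
  have hl' := hl.mono has
  set L : ℝ≥0 := K * a + ‖v x₀‖₊ + 1 with hL
  have hL0 : (0 : ℝ) < L := by positivity
  have hb : ∀ x ∈ closedBall x₀ (a : ℝ), ‖v x‖ ≤ L := by
    intro x hx
    have h1 := hl'.dist_le_mul x hx x₀ (mem_closedBall_self ha.le)
    have h2 : dist x x₀ ≤ a := hx
    have h3 : ‖v x‖ ≤ ‖v x₀‖ + dist (v x) (v x₀) := by
      rw [dist_eq_norm]; exact norm_le_norm_add_norm_sub' _ _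
    have h4 : (K : ℝ) * dist x x₀ ≤ K * a := by gcongr
    simp only [hL, NNReal.coe_add, NNReal.coe_mul, coe_nnnorm, NNReal.coe_one]
    linarith
  have ha' : (0 : ℝ) < a := ha
  have hε : 0 < (a : ℝ) / 2 / L := by positivity
  have hpl : IsPicardLindelof (fun _ => v) (tmin := 0) (tmax := (a : ℝ) / 2 / L)
      ⟨0, le_rfl, hε.le⟩ x₀ a (a / 2) L K := by
    refine IsPicardLindelof.of_time_independent hb hl' ?_
    simp only [sub_zero, sub_self, max_eq_left hε.le, NNReal.coe_div, NNReal.coe_ofNat]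
    field_simp
    norm_num
  refine ⟨_, hε, (a : ℝ) / 2, by positivity, fun x hx => ?_⟩
  exact hpl.exists_eq_forall_mem_Icc_hasDerivWithinAt (by simpa using hx)

section Hilbert

variable {H : Type*} [NormedAddCommGroup H] [InnerProductSpace ℝ H]

theorem Convex.norm_sq_le_inner_of_forall_norm_le {K : Set H} (hK : Convex ℝ K) {p q : H}
    (hp : p ∈ K) (hmin : ∀ q ∈ K, ‖p‖ ≤ ‖q‖) (hq : q ∈ K) : ‖p‖ ^ 2 ≤ ⟪q, p⟫ := by
  have hne : Nonempty K := ⟨⟨p, hp⟩⟩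
  have h := (norm_eq_iInf_iff_real_inner_le_zero hK (u := 0) hp).1 (by
    refine le_antisymm (le_ciInf fun w => by simpa using hmin w w.2) ?_
    exact ciInf_le ⟨0, by rintro _ ⟨w, rfl⟩; positivity⟩ (⟨p, hp⟩ : K)) q hq
  rw [zero_sub, inner_neg_left, inner_sub_right, real_inner_self_eq_norm_sq,
    real_inner_comm] at h
  linarith

theorem norm_sub_le_of_monotone_flow {u y u' y' : ℝ → H} {ε : ℝ}
    (hu : ∀ t ∈ Icc 0 ε, HasDerivWithinAt u (u' t) (Icc 0 ε) t)
    (hy : ∀ t ∈ Icc 0 ε, HasDerivWithinAt y (y' t) (Icc 0 ε) t)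
    (hmono : ∀ t ∈ Icc 0 ε, ⟪y t - u t, y' t - u' t⟫ ≤ 0) {t : ℝ} (ht : t ∈ Icc 0 ε) :
    ‖y t - u t‖ ≤ ‖y 0 - u 0‖ := by
  have hd : ∀ t ∈ Icc 0 ε, HasDerivWithinAt (fun t => ‖y t - u t‖ ^ 2)
      (2 * ⟪y t - u t, y' t - u' t⟫) (Icc 0 ε) t := fun t ht => ((hy t ht).sub (hu t ht)).norm_sq
  have hanti : AntitoneOn (fun t => ‖y t - u t‖ ^ 2) (Icc 0 ε) :=
    antitoneOn_of_hasDerivWithinAt_nonpos (convex_Icc 0 ε)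
      (fun t ht => (hd t ht).continuousWithinAt)
      (fun t ht => (hd t (interior_subset ht)).mono interior_subset)
      (fun t ht => by linarith [hmono t (interior_subset ht)])
  have := hanti (left_mem_Icc.2 (ht.1.trans ht.2)) ht ht.1
  exact (sq_le_sq₀ (norm_nonneg _) (norm_nonneg _)).1 this

variable [CompleteSpace H]

theorem HasGradientAt.comp_hasDerivWithinAt {f : H → ℝ} {u : ℝ → H} {v u' : H} {s : Set ℝ}
    {t : ℝ} (hf : HasGradientAt f v (u t)) (hu : HasDerivWithinAt u u' s t) :
    HasDerivWithinAt (fun t => f (u t)) ⟪v, u'⟫ s t := by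
  simpa [Function.comp_def] using! hf.hasFDerivAt.comp_hasDerivWithinAt t hu

theorem HasGradientAt.hasDerivAt_line {f : H → ℝ} {v x : H} (hf : HasGradientAt f v x) (w : H) :
    HasDerivAt (fun t : ℝ => f (x + t • w)) ⟪v, w⟫ 0 := by
  have hl : HasDerivAt (fun t : ℝ => x + t • w) w 0 := by
    simpa using ((hasDerivAt_id (0 : ℝ)).smul_const w).const_add x
  have hf' : HasGradientAt f v (x + (0 : ℝ) • w) := by simpa using hf
  simpa [Function.comp_def] using! hf'.hasFDerivAt.comp_hasDerivAt (0 : ℝ) hl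

theorem ConvexOn.add_inner_le_of_hasGradientAt {f : H → ℝ} (hc : ConvexOn ℝ univ f) {v x : H}
    (hf : HasGradientAt f v x) (y : H) : f x + ⟪v, y - x⟫ ≤ f y := by
  have hline : ConvexOn ℝ univ (fun t : ℝ => f (x + t • (y - x))) := by
    refine ⟨convex_univ, fun s _ t _ α β hα hβ hαβ => ?_⟩
    have := hc.2 (mem_univ (x + s • (y - x))) (mem_univ (x + t • (y - x))) hα hβ hαβ
    convert this using 2
    have hx : x = α • x + β • x := by rw [← add_smul, hαβ, one_smul]
    nth_rewrite 1 [hx]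
    simp only [smul_eq_mul]
    module
  have := hline.le_slope_of_hasDerivAt (mem_univ 0) (mem_univ 1) one_pos
    (hf.hasDerivAt_line (y - x))
  simp [slope_def_field] at this
  linarith

theorem ConvexOn.inner_sub_nonneg_of_hasGradientAt {f : H → ℝ} (hc : ConvexOn ℝ univ f)
    {v w x y : H} (hx : HasGradientAt f v x) (hy : HasGradientAt f w y) :
    0 ≤ ⟪v - w, x - y⟫ := by
  have h1 := hc.add_inner_le_of_hasGradientAt hx y
  have h2 := hc.add_inner_le_of_hasGradientAt hy x
  rw [← neg_sub x y, inner_neg_right] at h1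
  rw [inner_sub_left]
  linarith

theorem mem_closure_range_of_bddBelow {f : H → ℝ} {a : H → H}
    (hf : ∀ x, HasGradientAt f (a x) x) {y : H} {m : ℝ} (hm : ∀ x, m ≤ f x - ⟪y, x⟫) :
    y ∈ closure (range a) := by
  rw [Metric.mem_closure_range_iff]
  intro ε hε
  have hcont : Continuous fun x => f x - ⟪y, x⟫ :=
    (continuous_iff_continuousAt.2 fun x => (hf x).continuousAt).sub (by fun_prop)
  obtain ⟨z, -, hz⟩ := exists_forall_eq_of_add_dist_le hcont (E := fun _ => (0 : ℝ))
    continuous_const hm (half_pos hε) 0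
  refine ⟨z, ?_⟩
  by_contra! hlt
  rw [dist_comm, dist_eq_norm] at hlt
  set w := a z - y with hw
  have hwpos : 0 < ‖w‖ := hε.trans_le hlt
  have hder : HasDerivAt (fun t : ℝ => f (z + t • (-w)) - ⟪y, z + t • (-w)⟫
      + t * (ε / 2 * ‖w‖)) (⟪a z, -w⟫ - ⟪y, -w⟫ + ε / 2 * ‖w‖) 0 := by
    have h2 : HasDerivAt (fun t : ℝ => ⟪y, z + t • (-w)⟫) ⟪y, -w⟫ 0 := by
      have : HasDerivAt (fun t : ℝ => ⟪y, z⟫ + t * ⟪y, -w⟫) ⟪y, -w⟫ 0 := by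
        simpa using ((hasDerivAt_id (0 : ℝ)).mul_const ⟪y, -w⟫).const_add ⟪y, z⟫
      refine this.congr_of_eventuallyEq (Eventually.of_forall fun t => ?_)
      simp only [inner_add_right, inner_smul_right]
    exact (((hf z).hasDerivAt_line (-w)).sub h2).add
      (by simpa using (hasDerivAt_id (0 : ℝ)).mul_const (ε / 2 * ‖w‖))
  have hneg : ⟪a z, -w⟫ - ⟪y, -w⟫ + ε / 2 * ‖w‖ < 0 := by
    rw [← inner_sub_left, ← hw, inner_neg_right, real_inner_self_eq_norm_sq]
    nlinarith
  have hev := (hasDerivWithinAt_iff_tendsto_slope' (by simp)).1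
    (hder.hasDerivWithinAt (s := Ioi 0)) |>.eventually (gt_mem_nhds hneg)
  obtain ⟨t, ht, ht0⟩ := (hev.and self_mem_nhdsWithin).exists
  have ht0 : 0 < t := ht0
  rw [slope_def_field, div_lt_iff₀ (by simpa using ht0)] at ht
  have hzeq := hz (z + t • (-w)) (by
    have : dist z (z + t • (-w)) = t * ‖w‖ := by
      simp [dist_eq_norm, norm_smul, abs_of_pos ht0]
    rw [this]
    simp at ht ⊢
    linarith) le_rfl
  have : t • (-w) = 0 := by simpa using hzeq
  rcases smul_eq_zero.1 this with h | h
  · exact ht0.ne' h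
  · exact hwpos.ne' (by simpa using h)

/-- The closure of the range of the gradient of a convex function is convex. -/
theorem ConvexOn.convex_closure_range_of_hasGradientAt {f : H → ℝ} {a : H → H}
    (hc : ConvexOn ℝ univ f) (hf : ∀ x, HasGradientAt f (a x) x) :
    Convex ℝ (closure (range a)) := by
  have key : ∀ x y : H, ∀ α β : ℝ, 0 ≤ α → 0 ≤ β → α + β = 1 →
      α • a x + β • a y ∈ closure (range a) := by
    intro x y α β hα hβ hαβ
    refine mem_closure_range_of_bddBelow hf
      (m := α * (f x - ⟪a x, x⟫) + β * (f y - ⟪a y, y⟫)) fun z => ?_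
    have h1 := hc.add_inner_le_of_hasGradientAt (hf x) z
    have h2 := hc.add_inner_le_of_hasGradientAt (hf y) z
    simp only [inner_sub_right, inner_add_left, inner_smul_left, conj_trivial] at *
    have h3 := mul_le_mul_of_nonneg_left h1 hα
    have h4 := mul_le_mul_of_nonneg_left h2 hβ
    have h5 : f z = α * f z + β * f z := by rw [← add_mul, hαβ, one_mul]
    rw [h5]
    linarith
  intro p hp q hq α β hα hβ hαβ
  have hcont : Continuous fun w : H × H => α • w.1 + β • w.2 := by fun_prop
  have := map_mem_closure₂ (f := fun v w : H => α • v + β • w) (by exact hcont) hp hq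
    (u := closure (range a))
    (by rintro _ ⟨x, rfl⟩ _ ⟨y, rfl⟩; exact key x y α β hα hβ hαβ)
  simpa using this

theorem norm_gradient_le_of_eventually_sub_le {d : H → ℝ} {v w x z : H}
    (hx : HasGradientAt d v x) (hz : HasGradientAt d w z)
    (h : ∀ᶠ ξ in 𝓝 (0 : H), ∃ η, ‖η‖ ≤ ‖ξ‖ ∧ d (x + ξ) - d x ≤ d (z + η) - d z) :
    ‖v‖ ≤ ‖w‖ := by
  refine le_of_forall_pos_le_add fun c hc => ?_
  by_contra! hlt
  have hv : 0 < ‖v‖ := by linarith [norm_nonneg w]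
  have hz' := (hasGradientAt_iff_isLittleO_nhds_zero.1 hz).def (half_pos hc)
  obtain ⟨r, hr, hball⟩ := Metric.eventually_nhds_iff.1 hz'
  have hx' := (hasGradientAt_iff_isLittleO_nhds_zero.1 hx).def (half_pos hc)
  have hev : ∀ᶠ ξ in 𝓝 (0 : H), ‖ξ‖ < r := by
    filter_upwards [Metric.ball_mem_nhds (0 : H) hr] with ξ hξ using by simpa using hξ
  have hlim : Tendsto (fun s : ℝ => s • v) (𝓝[>] 0) (𝓝 0) := by
    have : Tendsto (fun s : ℝ => s • v) (𝓝 0) (𝓝 ((0 : ℝ) • v)) :=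
      (continuous_id.smul continuous_const).tendsto 0
    rw [zero_smul] at this
    exact this.mono_left nhdsWithin_le_nhds
  obtain ⟨s, ⟨⟨η, hη, hle⟩, hxs, hsr⟩, hs⟩ :=
    ((hlim.eventually (h.and (hx'.and hev))).and self_mem_nhdsWithin).exists
  have hs : 0 < s := hs
  have hzη := hball (y := η) (by simpa using hη.trans_lt hsr)
  have hns : ‖s • v‖ = s * ‖v‖ := by rw [norm_smul, Real.norm_of_nonneg hs.le]
  rw [hns] at hη hxs
  rw [inner_smul_right, real_inner_self_eq_norm_sq, Real.norm_eq_abs] at hxs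
  rw [Real.norm_eq_abs] at hzη
  have h1 := (abs_le.1 hxs).1
  have h2 := (abs_le.1 hzη).2
  have h3 : ⟪w, η⟫ ≤ ‖w‖ * ‖η‖ := real_inner_le_norm w η
  have h4 : (‖w‖ + c / 2) * ‖η‖ ≤ (‖w‖ + c / 2) * (s * ‖v‖) := by gcongr
  have h5 : s * ‖v‖ * ‖v‖ ≤ s * ‖v‖ * (‖w‖ + c) := by nlinarith
  exact absurd (le_of_mul_le_mul_left h5 (by positivity)) (not_le.2 hlt)

/-- Along the gradient flow of `f`, the norm `‖∇f - ∇g‖` does not decrease. -/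
theorem exists_gradient_flow_norm_sub_le {f g : H → ℝ} {a b : H → H}
    (hgc : ConvexOn ℝ univ g) (hfc : ConvexOn ℝ univ f)
    (hf : ∀ x, HasGradientAt f (a x) x) (hg : ∀ x, HasGradientAt g (b x) x)
    (ha : LocallyLipschitz a) (hb : LocallyLipschitz b) (hab : ∀ x, ‖a x‖ = ‖b x‖) (z : H) :
    ∃ ε > 0, ∃ u : ℝ → H, u 0 = z ∧ HasDerivWithinAt u (-a z) (Icc 0 ε) 0 ∧
      ∀ t ∈ Icc 0 ε, ‖a z - b z‖ ≤ ‖a (u t) - b (u t)‖ := by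
  have hfst : LocallyLipschitz fun w : H × H => a w.1 :=
    ha.comp LipschitzWith.prod_fst.locallyLipschitz
  have hfst' : LocallyLipschitz fun w : H × H => b w.1 :=
    hb.comp LipschitzWith.prod_fst.locallyLipschitz
  have hsnd : LocallyLipschitz fun w : H × H => b w.2 :=
    hb.comp LipschitzWith.prod_snd.locallyLipschitz
  have hv : LocallyLipschitz fun w : H × H => (-a w.1, -b w.2 - (a w.1 - b w.1)) :=
    hfst.neg.prodMk (hsnd.neg.sub (hfst.sub hfst'))
  obtain ⟨ε, hε, r, hr, hsol⟩ := hv.exists_hasDerivWithinAt_Icc (z, z)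
  have hsol' : ∀ ξ : H, ‖ξ‖ ≤ r → ∃ u y : ℝ → H, u 0 = z ∧ y 0 = z + ξ ∧
      (∀ t ∈ Icc 0 ε, HasDerivWithinAt u (-a (u t)) (Icc 0 ε) t) ∧
      ∀ t ∈ Icc 0 ε, HasDerivWithinAt y (-b (y t) - (a (u t) - b (u t))) (Icc 0 ε) t := by
    intro ξ hξ
    obtain ⟨α, hα0, hα⟩ := hsol (z, z + ξ) (by
      simpa [Prod.dist_eq, dist_eq_norm, hr.le] using hξ)
    refine ⟨fun t => (α t).1, fun t => (α t).2, by simp [hα0], by simp [hα0], fun t ht => ?_,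
      fun t ht => ?_⟩
    · exact (hα t ht).fst
    · exact (hα t ht).snd
  obtain ⟨u, -, hu0, -, hu, -⟩ := hsol' 0 (by simpa using hr.le)
  have h0 : (0 : ℝ) ∈ Icc 0 ε := left_mem_Icc.2 hε.le
  refine ⟨ε, hε, u, hu0, by simpa [hu0] using hu 0 h0, fun t ht => ?_⟩
  have hd : ∀ x, HasGradientAt (fun x => f x - g x) (a x - b x) x := by
    intro x
    rw [hasGradientAt_iff_hasFDerivAt, map_sub]
    exact (hf x).hasFDerivAt.sub (hg x).hasFDerivAt
  refine norm_gradient_le_of_eventually_sub_le (hd z) (hd (u t)) ?_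
  filter_upwards [Metric.closedBall_mem_nhds (0 : H) hr] with ξ hξ
  obtain ⟨u₁, y, hu₁0, hy0, hu₁, hy⟩ := hsol' ξ (by simpa using hξ)
  have huu : ∀ t ∈ Icc 0 ε, u₁ t = u t := by
    intro t ht
    have := norm_sub_le_of_monotone_flow hu hu₁ (fun t _ => by
      have := hfc.inner_sub_nonneg_of_hasGradientAt (hf (u₁ t)) (hf (u t))
      rw [show -a (u₁ t) - -a (u t) = -(a (u₁ t) - a (u t)) by abel, inner_neg_right,
        real_inner_comm]
      linarith) ht
    rw [hu₁0, hu0, sub_self, norm_zero] at this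
    exact sub_eq_zero.1 (norm_le_zero_iff.1 this)
  rw [← huu t ht]
  refine ⟨y t - u₁ t, ?_, ?_⟩
  · have := norm_sub_le_of_monotone_flow hu₁ hy (fun t _ => by
      have := hgc.inner_sub_nonneg_of_hasGradientAt (hg (y t)) (hg (u₁ t))
      rw [show -b (y t) - (a (u₁ t) - b (u₁ t)) - -a (u₁ t) = -(b (y t) - b (u₁ t)) by abel,
        inner_neg_right, real_inner_comm]
      linarith) ht
    simpa [hy0, hu₁0] using this
  · have hder : ∀ t ∈ Icc 0 ε, HasDerivWithinAt
        (fun t => (f (y t) - g (y t)) - (f (u₁ t) - g (u₁ t)))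
        (⟪a (y t) - b (y t), -b (y t) - (a (u₁ t) - b (u₁ t))⟫ - ⟪a (u₁ t) - b (u₁ t), -a (u₁ t)⟫)
        (Icc 0 ε) t := fun t ht =>
      ((hd (y t)).comp_hasDerivWithinAt (hy t ht)).sub
        ((hd (u₁ t)).comp_hasDerivWithinAt (hu₁ t ht))
    have hmono : MonotoneOn (fun t => (f (y t) - g (y t)) - (f (u₁ t) - g (u₁ t))) (Icc 0 ε) := by
      refine monotoneOn_of_hasDerivWithinAt_nonneg (convex_Icc 0 ε)
        (fun t ht => (hder t ht).continuousWithinAt)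
        (fun t ht => (hder t (interior_subset ht)).mono interior_subset) fun t _ => ?_
      have h1 : ⟪a (y t), a (y t)⟫ = ⟪b (y t), b (y t)⟫ := by
        simp only [real_inner_self_eq_norm_sq, hab]
      have h2 : ⟪a (u₁ t), a (u₁ t)⟫ = ⟪b (u₁ t), b (u₁ t)⟫ := by
        simp only [real_inner_self_eq_norm_sq, hab]
      have h3 : 0 ≤ ⟪(a (y t) - b (y t)) - (a (u₁ t) - b (u₁ t)),
        (a (y t) - b (y t)) - (a (u₁ t) - b (u₁ t))⟫ := real_inner_self_nonneg
      have c1 := real_inner_comm (a (y t)) (b (y t))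
      have c2 := real_inner_comm (a (u₁ t)) (b (u₁ t))
      have c3 := real_inner_comm (a (y t)) (a (u₁ t))
      have c4 := real_inner_comm (a (y t)) (b (u₁ t))
      have c5 := real_inner_comm (b (y t)) (a (u₁ t))
      have c6 := real_inner_comm (b (y t)) (b (u₁ t))
      simp only [inner_sub_left, inner_sub_right, inner_neg_right] at h3 ⊢
      linarith
    have := hmono h0 ht ht.1
    simpa [hy0, hu₁0] using this

/-- From any point one can reach a point where `‖∇f‖` is almost minimal without decreasing
`‖∇f - ∇g‖`. -/
theorem exists_norm_gradient_le_and_norm_sub_le {f g : H → ℝ} {a b : H → H}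
    (hfc : ConvexOn ℝ univ f) (hgc : ConvexOn ℝ univ g)
    (hf : ∀ x, HasGradientAt f (a x) x) (hg : ∀ x, HasGradientAt g (b x) x)
    (ha : LocallyLipschitz a) (hb : LocallyLipschitz b) (hab : ∀ x, ‖a x‖ = ‖b x‖)
    (x₀ y : H) {κ : ℝ} (hκ : 0 < κ) :
    ∃ z, ‖a z‖ ≤ ‖a y‖ + κ ∧ ‖a x₀ - b x₀‖ ≤ ‖a z - b z‖ := by
  have hF : ∀ x, HasGradientAt (fun x => f x - ⟪a y, x⟫) (a x - a y) x := by
    intro x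
    rw [hasGradientAt_iff_hasFDerivAt, map_sub]
    exact (hf x).hasFDerivAt.sub (InnerProductSpace.toDual ℝ H (a y)).hasFDerivAt
  obtain ⟨z, hz0, hz⟩ := exists_forall_eq_of_add_dist_le
    (F := fun x => f x - ⟪a y, x⟫) (E := fun x => ‖a x - b x‖) (m := f y - ⟪a y, y⟫)
    (continuous_iff_continuousAt.2 fun x => (hF x).continuousAt)
    (ha.continuous.sub hb.continuous).norm
    (fun x => by
      have := hfc.add_inner_le_of_hasGradientAt (hf y) x
      rw [inner_sub_right] at this
      linarith) hκ x₀
  refine ⟨z, ?_, hz0⟩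
  by_contra! hlt
  obtain ⟨ε, hε, u, hu0, hu, hmono⟩ := exists_gradient_flow_norm_sub_le hgc hfc hf hg ha hb hab z
  have hu' : HasDerivWithinAt u (-a z) (Ioi 0) 0 :=
    (hu.mono_of_mem_nhdsWithin (Icc_mem_nhdsGE hε)).mono Ioi_subset_Ici_self
  have hpos : 0 < ‖a z‖ := by linarith [norm_nonneg (a y)]
  have hs1 : Tendsto (fun t => t⁻¹ * (f (u t) - ⟪a y, u t⟫ - (f z - ⟪a y, z⟫))) (𝓝[>] 0)
      (𝓝 ⟪a z - a y, -a z⟫) := by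
    have h := (hasDerivWithinAt_iff_tendsto_slope' (by simp)).1
      (HasGradientAt.comp_hasDerivWithinAt (by simpa [hu0] using hF z) hu')
    simpa [slope_fun_def, hu0] using h
  have hs2 : Tendsto (fun t => ‖t⁻¹ • (u t - z)‖) (𝓝[>] 0) (𝓝 ‖-a z‖) := by
    have h := ((hasDerivWithinAt_iff_tendsto_slope' (by simp)).1 hu').norm
    simpa [slope_fun_def, hu0] using h
  have hneg : ⟪a z - a y, -a z⟫ + κ * ‖-a z‖ < 0 := by
    rw [inner_neg_right, inner_sub_left, real_inner_self_eq_norm_sq, norm_neg]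
    have := real_inner_le_norm (a y) (a z)
    nlinarith
  have hev := (hs1.add (hs2.const_mul κ)).eventually (gt_mem_nhds hneg)
  obtain ⟨t, ht, htI⟩ := (hev.and (Ioc_mem_nhdsGT hε)).exists
  have ht0 : 0 < t := htI.1
  rw [norm_smul, norm_inv, Real.norm_of_nonneg ht0.le] at ht
  have hlt' : f (u t) - ⟪a y, u t⟫ - (f z - ⟪a y, z⟫) + κ * ‖u t - z‖ < 0 := by
    have := mul_neg_of_pos_of_neg ht0 ht
    field_simp at this
    linarith
  have hzu := hz (u t) (by rw [dist_comm, dist_eq_norm]; linarith) (hmono t ⟨ht0.le, htI.2⟩)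
  rw [hzu] at hlt'
  simp at hlt'

end Hilbert

/-- **Determination of convex `C^{1,1}_loc` functions on a Hilbert space.**
If `f, g : H → ℝ` are convex, Fréchet differentiable with locally Lipschitz gradients,
have equal gradient norms everywhere, and have the same Crandall–Pazy direction
(the element of minimal norm of the closure of the range of the gradient),
then `f` and `g` differ by an additive constant. -/
theorem determination_C11loc_hilbert
    {H : Type*} [NormedAddCommGroup H] [InnerProductSpace ℝ H] [CompleteSpace H]
    (f g : H → ℝ)
    (hfconv : ConvexOn ℝ Set.univ f) (hgconv : ConvexOn ℝ Set.univ g)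
    (hfdiff : ∀ x, DifferentiableAt ℝ f x) (hgdiff : ∀ x, DifferentiableAt ℝ g x)
    (hflip : LocallyLipschitz (gradient f)) (hglip : LocallyLipschitz (gradient g))
    (pf pg : H)
    (hpf : pf ∈ closure (Set.range (gradient f)) ∧
      ∀ q ∈ closure (Set.range (gradient f)), ‖pf‖ ≤ ‖q‖)
    (hpg : pg ∈ closure (Set.range (gradient g)) ∧
      ∀ q ∈ closure (Set.range (gradient g)), ‖pg‖ ≤ ‖q‖)
    (hnorm : ∀ x, ‖gradient f x‖ = ‖gradient g x‖)
    (hp : pf = pg) :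
    ∃ c : ℝ, ∀ x, f x = g x + c := by
  have hf : ∀ x, HasGradientAt f (gradient f x) x := fun x => (hfdiff x).hasGradientAt
  have hg : ∀ x, HasGradientAt g (gradient g x) x := fun x => (hgdiff x).hasGradientAt
  subst hp
  have hclose : ∀ (q : H) (δ : ℝ), 0 < δ → ‖pf‖ ^ 2 ≤ inner ℝ q pf → ‖q‖ ≤ ‖pf‖ + δ →
      ‖q - pf‖ ^ 2 ≤ δ * (2 * ‖pf‖ + δ) := by
    intro q δ hδ h1 h2
    rw [norm_sub_sq_real]
    nlinarith [norm_nonneg q, norm_nonneg pf]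
  have heq : ∀ x, gradient f x = gradient g x := by
    intro x
    have hbound : ∀ δ : ℝ, 0 < δ →
        ‖gradient f x - gradient g x‖ ^ 2 ≤ 4 * (δ * (2 * ‖pf‖ + δ)) := by
      intro δ hδ
      obtain ⟨y, hy⟩ := Metric.mem_closure_range_iff.1 hpf.1 (δ / 2) (half_pos hδ)
      have hy' : ‖gradient f y‖ ≤ ‖pf‖ + δ / 2 := by
        rw [dist_comm, dist_eq_norm] at hy
        linarith [norm_le_norm_add_norm_sub' (gradient f y) pf]
      obtain ⟨z, hz, hxz⟩ := exists_norm_gradient_le_and_norm_sub_le hfconv hgconv hf hg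
        hflip hglip hnorm x y (half_pos hδ)
      have hfz := hclose (gradient f z) δ hδ
        ((hfconv.convex_closure_range_of_hasGradientAt hf).norm_sq_le_inner_of_forall_norm_le
          hpf.1 hpf.2 (subset_closure (mem_range_self z))) (by linarith)
      have hgz := hclose (gradient g z) δ hδ
        ((hgconv.convex_closure_range_of_hasGradientAt hg).norm_sq_le_inner_of_forall_norm_le
          hpg.1 hpg.2 (subset_closure (mem_range_self z))) (by rw [← hnorm]; linarith)
      have htri := norm_sub_le_norm_sub_add_norm_sub (gradient f z) pf (gradient g z)
      rw [norm_sub_rev pf] at htri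
      have hle := hxz.trans htri
      have hsq : ‖gradient f x - gradient g x‖ ^ 2 ≤
          (‖gradient f z - pf‖ + ‖gradient g z - pf‖) ^ 2 := by gcongr
      nlinarith [sq_nonneg (‖gradient f z - pf‖ - ‖gradient g z - pf‖)]
    have hlim : Tendsto (fun δ : ℝ => 4 * (δ * (2 * ‖pf‖ + δ))) (𝓝[>] 0) (𝓝 0) := by
      have hc : Continuous fun δ : ℝ => 4 * (δ * (2 * ‖pf‖ + δ)) := by fun_prop
      simpa using (hc.tendsto 0).mono_left nhdsWithin_le_nhds
    have h0 : ‖gradient f x - gradient g x‖ ^ 2 ≤ 0 :=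
      ge_of_tendsto hlim (by filter_upwards [self_mem_nhdsWithin] with δ hδ using hbound δ hδ)
    have h1 : ‖gradient f x - gradient g x‖ = 0 :=
      pow_eq_zero_iff two_ne_zero |>.1 (le_antisymm h0 (by positivity))
    exact sub_eq_zero.1 (norm_eq_zero.1 h1)
  refine ⟨f 0 - g 0, fun x => ?_⟩
  have hder : ∀ x, HasFDerivAt (fun x => f x - g x) (0 : H →L[ℝ] ℝ) x := by
    intro x
    have := (hf x).hasFDerivAt.sub (hg x).hasFDerivAt
    rwa [heq, sub_self] at this
  have := is_const_of_fderiv_eq_zero (𝕜 := ℝ) (fun x => (hder x).differentiableAt)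
    (fun x => (hder x).fderiv) x 0
  linarith
end

section
/- Let f, g : ℝ^d → ℝ be convex functions of class C^{1,1}_loc (differentiable with locally Lipschitz gradient). Assume (i) ‖∇f(x)‖ = ‖∇g(x)‖ for all x ∈ ℝ^d, and (ii) p_f = p_g, where p_f (resp. p_g) is the Crandall–Pazy direction of f (resp. g). Then there exists a constant c ∈ ℝ such that f(x) = g(x) + c for all x ∈ ℝ^d. -/
open Set Filter

open scoped Topology RealInnerProductSpace NNReal
open MeasureTheory

lemma LocallyLipschitz.norm_sub_sq {E : Type*} [NormedAddCommGroup E]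
    [InnerProductSpace ℝ E] {φ χ : E → E} (hφ : LocallyLipschitz φ)
    (hχ : LocallyLipschitz χ) : LocallyLipschitz fun y => ‖φ y - χ y‖ ^ 2 := by
  have h1 : LocallyLipschitz (fun z : E => ‖z‖ ^ 2) :=
    (contDiff_norm_sq ℝ (n := 1)).locallyLipschitz
  have h2 : LocallyLipschitz (fun z : E × E => z.1 - z.2) :=
    (LipschitzWith.prod_fst.sub LipschitzWith.prod_snd).locallyLipschitz
  have h3 : LocallyLipschitz (fun y => (φ y, χ y)) := hφ.prodMk hχ
  exact (h1.comp h2).comp h3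

section InnerProduct
variable {E : Type*} [NormedAddCommGroup E] [InnerProductSpace ℝ E] [CompleteSpace E]

/-- A differentiable convex function lies above its tangent planes. -/
lemma ConvexOn.add_inner_gradient_le {f : E → ℝ} (hf : ConvexOn ℝ univ f) {x : E}
    (hd : DifferentiableAt ℝ f x) (y : E) : f x + ⟪gradient f x, y - x⟫ ≤ f y := by
  have hc : ConvexOn ℝ univ (fun t : ℝ => f (AffineMap.lineMap x y t)) :=
    hf.comp_affineMap (AffineMap.lineMap x y)
  have h1 : HasDerivAt (fun t : ℝ => f (AffineMap.lineMap x y t)) (fderiv ℝ f x (y - x)) 0 := by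
    have h2 : HasFDerivAt f (fderiv ℝ f x) (AffineMap.lineMap x y (0 : ℝ)) := by
      simpa using hd.hasFDerivAt
    exact h2.comp_hasDerivAt (0 : ℝ) AffineMap.hasDerivAt_lineMap
  have := hc.le_slope_of_hasDerivAt (mem_univ (0 : ℝ)) (mem_univ (1 : ℝ)) one_pos h1
  rw [slope_def_field] at this
  simp only [AffineMap.lineMap_apply_one, AffineMap.lineMap_apply_zero, sub_zero, div_one] at this
  rw [inner_gradient_left]
  linarith

/-- The gradient of a convex function is monotone. -/
lemma ConvexOn.inner_gradient_sub_nonneg {f : E → ℝ} (hf : ConvexOn ℝ univ f)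
    (hd : Differentiable ℝ f) (x y : E) : 0 ≤ ⟪gradient f y - gradient f x, y - x⟫ := by
  have h1 := hf.add_inner_gradient_le (hd x) y
  have h2 := hf.add_inner_gradient_le (hd y) x
  rw [← neg_sub y x, inner_neg_right] at h2
  rw [inner_sub_left]
  linarith

/-- The derivative of a gradient is a symmetric operator. -/
lemma inner_fderiv_gradient_comm {f : E → ℝ} (hd : Differentiable ℝ f) {x : E}
    {A : E →L[ℝ] E} (hA : HasFDerivAt (gradient f) A x) (v w : E) : ⟪A v, w⟫ = ⟪A w, v⟫ := by
  have h1 : HasFDerivAt (fun y => InnerProductSpace.toDual ℝ E (gradient f y))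
      ((InnerProductSpace.toDual ℝ E).toContinuousLinearEquiv.toContinuousLinearMap.comp A) x :=
    (InnerProductSpace.toDual ℝ E).toContinuousLinearEquiv.toContinuousLinearMap.hasFDerivAt.comp
      x hA
  have h2 := second_derivative_symmetric (𝕜 := ℝ)
    (fun y => by rw [toDual_gradient]; exact (hd y).hasFDerivAt) h1 v w
  simpa using h2

/-- The derivative of the gradient of a convex function is positive semidefinite. -/
lemma ConvexOn.inner_fderiv_gradient_nonneg {f : E → ℝ} (hf : ConvexOn ℝ univ f)
    (hd : Differentiable ℝ f) {x : E} {A : E →L[ℝ] E} (hA : HasFDerivAt (gradient f) A x)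
    (v : E) : 0 ≤ ⟪A v, v⟫ := by
  have h0 : HasDerivAt (fun t : ℝ => x + t • v) v 0 := by
    simpa using ((hasDerivAt_id (0 : ℝ)).smul_const v).const_add x
  have hA' : HasFDerivAt (gradient f) A (x + (0 : ℝ) • v) := by simpa using hA
  have h1 : HasDerivAt (fun t : ℝ => gradient f (x + t • v)) (A v) 0 :=
    hA'.comp_hasDerivAt (f := fun t : ℝ => x + t • v) (0 : ℝ) h0
  have h2 : Tendsto (fun t : ℝ => ⟪t⁻¹ • (gradient f (x + (0 + t) • v) -
      gradient f (x + (0 : ℝ) • v)), v⟫) (𝓝[>] 0) (𝓝 ⟪A v, v⟫) :=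
    h1.tendsto_slope_zero_right.inner tendsto_const_nhds
  refine ge_of_tendsto h2 ?_
  filter_upwards [self_mem_nhdsWithin] with t ht
  have ht : 0 < t := ht
  have h3 := hf.inner_gradient_sub_nonneg hd x (x + t • v)
  simp only [add_sub_cancel_left, inner_smul_right] at h3
  simp only [zero_add, zero_smul, add_zero, real_inner_smul_left]
  have := nonneg_of_mul_nonneg_right h3 ht
  positivity

/-- If two convex functions have gradients of equal norms, then the squared distance between the
gradients does not increase in the direction of one of the gradients. -/
lemma fderiv_norm_sub_gradient_sq_apply_le_zero {f g : E → ℝ} (hg : ConvexOn ℝ univ g)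
    (hfd : Differentiable ℝ f) (hgd : Differentiable ℝ g)
    (hnorm : ∀ x, ‖gradient f x‖ = ‖gradient g x‖) {x : E}
    (hf' : DifferentiableAt ℝ (gradient f) x) (hg' : DifferentiableAt ℝ (gradient g) x) :
    fderiv ℝ (fun y => ‖gradient f y - gradient g y‖ ^ 2) x (gradient f x) ≤ 0 := by
  obtain ⟨A, hA⟩ := hf'
  obtain ⟨B, hB⟩ := hg'
  set a := gradient f x with ha
  set b := gradient g x with hb
  have hsq : (fun y => ‖gradient f y‖ ^ 2) = fun y => ‖gradient g y‖ ^ 2 := by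
    funext y; rw [hnorm]
  have hAB : A a = B b := by
    refine ext_inner_right ℝ fun v => ?_
    have h1 := hA.norm_sq
    rw [hsq] at h1
    have h2 := congrArg (fun l : E →L[ℝ] ℝ => l v) (h1.unique hB.norm_sq)
    simp [← ha, ← hb] at h2
    rw [inner_fderiv_gradient_comm hfd hA, inner_fderiv_gradient_comm hgd hB,
      real_inner_comm, h2, real_inner_comm]
  have hD : HasFDerivAt (fun y => ‖gradient f y - gradient g y‖ ^ 2) _ x := (hA.sub hB).norm_sq
  rw [hD.fderiv]
  have h3 := hg.inner_fderiv_gradient_nonneg hgd hB (a - b)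
  rw [map_sub, real_inner_comm, inner_sub_left, inner_sub_right, inner_sub_right] at h3
  simp [← ha, ← hb, hAB]
  linarith

end InnerProduct

/-- One-sided version of the mean value inequality for a Lipschitz function on an interval whose
derivative is bounded above almost everywhere. -/
lemma LipschitzOnWith.sub_le_mul_of_ae_deriv_le {ψ : ℝ → ℝ} {K : ℝ≥0} {h C : ℝ} (hh : 0 ≤ h)
    (hψ : LipschitzOnWith K ψ (Icc 0 h)) (hC : ∀ᵐ t, t ∈ Icc 0 h → deriv ψ t ≤ C) :
    ψ h - ψ 0 ≤ C * h := by
  have hac : AbsolutelyContinuousOnInterval ψ 0 h :=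
    LipschitzOnWith.absolutelyContinuousOnInterval (by rwa [uIcc_of_le hh])
  rw [← hac.integral_deriv_eq_sub]
  have := intervalIntegral.integral_mono_ae_restrict (μ := volume) hh hac.intervalIntegrable_deriv
    (intervalIntegrable_const (c := C)) ((ae_restrict_iff' measurableSet_Icc).2 hC)
  simpa [mul_comm] using this

section FiniteDimensional
variable {E : Type*} [NormedAddCommGroup E] [InnerProductSpace ℝ E] [FiniteDimensional ℝ E]

/-- If a Lipschitz function `D` has a nonpositive derivative along a Lipschitz vector field `A`
almost everywhere, then `D` increases by at most a quadratic error along a step in direction `A`. -/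
lemma LipschitzOnWith.le_add_of_ae_fderiv_apply_le_zero [MeasurableSpace E] [BorelSpace E]
    {D : E → ℝ} {A : E → E} {L K : ℝ≥0} {c : E} {R : ℝ}
    (hD : LipschitzOnWith L D (Metric.ball c R)) (hA : LipschitzOnWith K A (Metric.ball c R))
    (hae : ∀ᵐ z, z ∈ Metric.ball c R → DifferentiableAt ℝ D z ∧ fderiv ℝ D z (A z) ≤ 0)
    {x : E} {h : ℝ} (hh : 0 ≤ h) (hx : x ∈ Metric.ball c R)
    (hxh : x + h • A x ∈ Metric.ball c R) :
    D (x + h • A x) ≤ D x + L * K * ‖A x‖ * h ^ 2 := by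
  set a := A x with ha
  obtain ⟨s, hs, hsm, hs'⟩ : ∃ s : Set E, (∀ z ∈ s, z ∈ Metric.ball c R →
      DifferentiableAt ℝ D z ∧ fderiv ℝ D z (A z) ≤ 0) ∧ MeasurableSet s ∧ ∀ᵐ z, z ∈ s := by
    obtain ⟨s, h1, h2, h3⟩ := exists_measurable_superset_of_null (ae_iff.1 hae)
    refine ⟨sᶜ, fun z hz => ?_, h2.compl, ?_⟩
    · by_contra hcon
      exact hz (h1 hcon)
    · rw [ae_iff]; simpa using h3
  have hline := (ae_ae_add_linearMap_mem_iff (LinearMap.toSpanSingleton ℝ E a)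
    (volume : Measure ℝ) (volume : Measure E) hsm).2 hs'
  have hnear : ∀ᶠ y in 𝓝 x, y ∈ Metric.ball c R ∧ y + h • a ∈ Metric.ball c R :=
    (Metric.isOpen_ball.eventually_mem hx).and
      ((by fun_prop : ContinuousAt (fun y => y + h • a) x).preimage_mem_nhds
        (Metric.isOpen_ball.mem_nhds hxh))
  have hfreq : ∃ᶠ y in 𝓝 x, D (y + h • a) - D y ≤ L * K * (‖y - x‖ + h * ‖a‖) * h := by
    have hd : Dense {y : E | ∀ᵐ t : ℝ, y + LinearMap.toSpanSingleton ℝ E a t ∈ s} :=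
      Measure.dense_of_ae hline
    refine ((mem_closure_iff_frequently.1 (hd x)).and_eventually hnear).mono ?_
    rintro y ⟨hy, hy1, hy2⟩
    have hseg : ∀ t ∈ Icc 0 h, y + t • a ∈ Metric.ball c R := by
      intro t ht
      rcases hh.eq_or_lt with h0 | h0
      · have : t = 0 := by rw [← h0] at ht; exact le_antisymm ht.2 ht.1
        simpa [this] using hy1
      have := (convex_ball c R).add_smul_sub_mem hy1 hy2 (t := t / h)
        ⟨div_nonneg ht.1 hh, (div_le_one h0).2 ht.2⟩
      rwa [add_sub_cancel_left, smul_smul, div_mul_cancel₀ _ h0.ne'] at this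
    have hlip : LipschitzOnWith (L * ‖a‖₊) (fun t : ℝ => D (y + t • a)) (Icc 0 h) := by
      have : LipschitzWith ‖a‖₊ (fun t : ℝ => y + t • a) := by
        refine LipschitzWith.of_dist_le_mul fun t u => ?_
        rw [dist_add_left, dist_eq_norm, ← sub_smul, norm_smul, dist_eq_norm, mul_comm]; rfl
      exact hD.comp this.lipschitzOnWith hseg
    have := hlip.sub_le_mul_of_ae_deriv_le hh (C := L * K * (‖y - x‖ + h * ‖a‖)) ?_
    · simpa using this
    filter_upwards [hy] with t ht htI
    have hz := hseg t htI
    obtain ⟨hdz, hle⟩ := hs _ ht hz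
    simp only [LinearMap.toSpanSingleton_apply] at hdz hle
    set z := y + t • a with hzdef
    have hder : HasDerivAt (fun t : ℝ => D (y + t • a)) (fderiv ℝ D z a) t := by
      refine HasFDerivAt.comp_hasDerivAt t hdz.hasFDerivAt ?_
      simpa using ((hasDerivAt_id t).smul_const a).const_add y
    rw [hder.deriv]
    have hnL : ‖fderiv ℝ D z‖ ≤ L :=
      norm_fderiv_le_of_lipschitzOn ℝ (Metric.isOpen_ball.mem_nhds hz) hD
    have hzx : ‖z - x‖ ≤ ‖y - x‖ + h * ‖a‖ := by
      have : z - x = (y - x) + t • a := by rw [hzdef]; abel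
      rw [this]
      refine (norm_add_le _ _).trans ?_
      rw [norm_smul, Real.norm_of_nonneg htI.1]
      gcongr
      exact htI.2
    calc fderiv ℝ D z a = fderiv ℝ D z (A z) + fderiv ℝ D z (a - A z) := by
          rw [← map_add]; congr 1; abel
      _ ≤ 0 + ‖fderiv ℝ D z‖ * ‖a - A z‖ :=
          add_le_add hle ((Real.le_norm_self _).trans (ContinuousLinearMap.le_opNorm _ _))
      _ ≤ L * (K * ‖z - x‖) := by
          rw [zero_add, norm_sub_rev]
          gcongr
          exact hA.norm_sub_le hz hx
      _ ≤ L * K * (‖y - x‖ + h * ‖a‖) := by rw [← mul_assoc]; gcongr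
  have hcont : ∀ z ∈ Metric.ball c R, ContinuousAt D z := fun z hz =>
    hD.continuousOn.continuousAt (Metric.isOpen_ball.mem_nhds hz)
  have hl : ContinuousAt (fun y => D (y + h • a) - D y) x :=
    (ContinuousAt.comp (f := fun y => y + h • a) (hcont _ hxh) (by fun_prop)).sub (hcont _ hx)
  have hr : ContinuousAt (fun y => L * K * (‖y - x‖ + h * ‖a‖) * h) x := by fun_prop
  by_contra! hcon
  have hlt : L * K * (‖x - x‖ + h * ‖a‖) * h < D (x + h • a) - D x := by
    rw [sub_self, norm_zero, zero_add]
    linarith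
  obtain ⟨y, h1, h2⟩ := (hfreq.and_eventually (hr.eventually_lt hl hlt)).exists
  exact absurd h1 (not_le.2 h2)

/-- The proximal point equation of a differentiable convex function is solvable. -/
lemma ConvexOn.exists_add_smul_gradient_eq {f : E → ℝ} (hf : ConvexOn ℝ univ f)
    (hd : Differentiable ℝ f) {h : ℝ} (hh : 0 < h) (x : E) : ∃ z, z + h • gradient f z = x := by
  have hcont : Continuous (fun z => f z + (2 * h)⁻¹ * ‖z - x‖ ^ 2) := by
    have := hd.continuous
    fun_prop
  obtain ⟨z, hz⟩ := hcont.exists_forall_le' x <| by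
    filter_upwards [(isCompact_closedBall x (2 * h * ‖gradient f x‖)).compl_mem_cocompact] with z hz
    have hz : 2 * h * ‖gradient f x‖ < ‖z - x‖ := by simpa [dist_eq_norm] using hz
    have h1 := hf.add_inner_gradient_le (hd x) z
    have h2 := neg_le_of_abs_le (abs_real_inner_le_norm (gradient f x) (z - x))
    have h3 : ‖gradient f x‖ ≤ (2 * h)⁻¹ * ‖z - x‖ := by
      rw [inv_mul_eq_div, le_div_iff₀ (by positivity)]
      linarith
    have h4 := mul_le_mul_of_nonneg_right h3 (norm_nonneg (z - x))
    rw [sub_self, norm_zero]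
    nlinarith
  have hder : HasFDerivAt (fun z => f z + (2 * h)⁻¹ * ‖z - x‖ ^ 2) _ z :=
    (hd z).hasFDerivAt.add ((((hasFDerivAt_id z).sub_const x).norm_sq).const_mul (2 * h)⁻¹)
  have hzero := IsLocalMin.hasFDerivAt_eq_zero (Eventually.of_forall hz) hder
  have hgrad : gradient f z + h⁻¹ • (z - x) = 0 := by
    refine ext_inner_right ℝ fun v => ?_
    have h1 := congrArg (fun l : E →L[ℝ] ℝ => l v) hzero
    simp at h1
    rw [inner_add_left, inner_gradient_left, inner_smul_left, inner_zero_left, inner_sub_left]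
    simp
    rw [← h1]
    ring
  refine ⟨z, ?_⟩
  have h2 := congrArg (fun w => h • w) hgrad
  simp only [smul_add, smul_smul, mul_inv_cancel₀ hh.ne', one_smul, smul_zero] at h2
  rw [← sub_eq_zero, ← h2]
  abel

/-- If `f - ⟪q, ·⟫` is bounded below, then `q` lies in the closure of the range of the gradient. -/
lemma ConvexOn.mem_closure_range_gradient {f : E → ℝ} (hf : ConvexOn ℝ univ f)
    (hd : Differentiable ℝ f) {q : E} {C : ℝ} (hq : ∀ y, -C ≤ f y - ⟪q, y⟫) :
    q ∈ closure (range (gradient f)) := by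
  refine Metric.mem_closure_range_iff.2 fun ε hε => ?_
  have hM : 0 ≤ f 0 + C := by simpa [add_comm] using neg_le_iff_add_nonneg.1 (hq 0)
  set η := ε ^ 2 / (f 0 + C + 1) with hη
  have hη0 : 0 < η := by positivity
  obtain ⟨z, hz⟩ := hf.exists_add_smul_gradient_eq hd (inv_pos.2 hη0) (η⁻¹ • q)
  have hgz : gradient f z = q - η • z := by
    have h2 := congrArg (fun w => η • w) hz
    simp only [smul_add, smul_smul, mul_inv_cancel₀ hη0.ne', one_smul] at h2
    rw [← h2]; abel
  refine ⟨z, ?_⟩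
  have h1 := hf.add_inner_gradient_le (hd z) 0
  have h2 := hq z
  rw [zero_sub, inner_neg_right, hgz, inner_sub_left, real_inner_smul_left,
    real_inner_self_eq_norm_sq] at h1
  have h3 : η * (f 0 + C + 1) = ε ^ 2 := div_mul_cancel₀ _ (by positivity)
  rw [dist_eq_norm, hgz, sub_sub_cancel, norm_smul, Real.norm_of_nonneg hη0.le]
  refine lt_of_pow_lt_pow_left₀ 2 hε.le ?_
  nlinarith

/-- A gradient whose norm is nearly minimal is close to the Crandall–Pazy direction. -/
lemma ConvexOn.norm_gradient_sub_sq_le {f : E → ℝ} (hf : ConvexOn ℝ univ f)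
    (hd : Differentiable ℝ f) {p : E} (hp : p ∈ closure (range (gradient f)))
    (hmin : ∀ q ∈ closure (range (gradient f)), ‖p‖ ≤ ‖q‖) (x : E) :
    ‖gradient f x - p‖ ^ 2 ≤ 2 * (‖gradient f x‖ ^ 2 - ‖p‖ ^ 2) := by
  have hmid : ∀ u, ‖p‖ ≤ ‖(2⁻¹ : ℝ) • (gradient f x + gradient f u)‖ := by
    intro u
    refine hmin _ (hf.mem_closure_range_gradient hd
      (C := -(2⁻¹ * (f x - ⟪gradient f x, x⟫ + (f u - ⟪gradient f u, u⟫)))) fun y => ?_)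
    have h1 := hf.add_inner_gradient_le (hd x) y
    have h2 := hf.add_inner_gradient_le (hd u) y
    rw [inner_sub_right] at h1 h2
    rw [real_inner_smul_left, inner_add_left]
    linarith
  have hcl : IsClosed {q : E | ‖p‖ ≤ ‖(2⁻¹ : ℝ) • (gradient f x + q)‖} :=
    isClosed_le continuous_const (by fun_prop)
  have h1 : ‖p‖ ≤ ‖(2⁻¹ : ℝ) • (gradient f x + p)‖ :=
    hcl.closure_subset_iff.2 (range_subset_iff.2 hmid) hp
  rw [norm_smul, Real.norm_of_nonneg (by norm_num)] at h1
  have h2 := parallelogram_law_with_norm ℝ (gradient f x) p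
  nlinarith [norm_nonneg p]

section ProximalSequence
variable {f : E → ℝ} {h : ℝ} {X : ℕ → E}

/-- Gradient norms decrease along a proximal sequence. -/
lemma ConvexOn.antitone_norm_gradient_of_proximal (hf : ConvexOn ℝ univ f)
    (hd : Differentiable ℝ f) (hh : 0 < h)
    (hX : ∀ k, X (k + 1) + h • gradient f (X (k + 1)) = X k) :
    Antitone fun k => ‖gradient f (X k)‖ := by
  refine antitone_nat_of_succ_le fun k => ?_
  have h1 := hf.inner_gradient_sub_nonneg hd (X (k + 1)) (X k)
  have h2 : X k - X (k + 1) = h • gradient f (X (k + 1)) := by rw [← hX k]; abel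
  rw [h2, real_inner_smul_right, inner_sub_left, real_inner_self_eq_norm_sq] at h1
  have h3 := nonneg_of_mul_nonneg_right h1 hh
  have h4 := real_inner_le_norm (gradient f (X k)) (gradient f (X (k + 1)))
  by_contra! hcon
  nlinarith [norm_nonneg (gradient f (X k))]

/-- A proximal sequence travels at most the elapsed time multiplied by the initial speed. -/
lemma ConvexOn.norm_proximal_sub_le (hf : ConvexOn ℝ univ f)
    (hd : Differentiable ℝ f) (hh : 0 < h)
    (hX : ∀ k, X (k + 1) + h • gradient f (X (k + 1)) = X k) (n : ℕ) :
    ‖X n - X 0‖ ≤ n * h * ‖gradient f (X 0)‖ := by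
  induction n with
  | zero => simp
  | succ n ih =>
    have h1 : X (n + 1) - X 0 = (X n - X 0) - h • gradient f (X (n + 1)) := by
      rw [← hX n]; abel
    rw [h1]
    refine (norm_sub_le _ _).trans ?_
    rw [norm_smul, Real.norm_of_nonneg hh.le]
    have := mul_le_mul_of_nonneg_left
      (hf.antitone_norm_gradient_of_proximal hd hh hX (Nat.zero_le (n + 1))) hh.le
    push_cast
    linarith

/-- After a long enough time, the gradient norm along a proximal sequence is almost below the
gradient norm at any given point. -/
lemma ConvexOn.norm_gradient_proximal_lt (hf : ConvexOn ℝ univ f)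
    (hd : Differentiable ℝ f) (hh : 0 < h)
    (hX : ∀ k, X (k + 1) + h • gradient f (X (k + 1)) = X k) (u : E) {ε : ℝ} (hε : 0 < ε)
    {n : ℕ} (hn : f (X 0) - f u - ⟪gradient f u, X 0 - u⟫ < n * h * ε ^ 2) :
    ‖gradient f (X n)‖ < ‖gradient f u‖ + ε := by
  by_contra! hcon
  have key : ∀ k ≤ n, f (X k) - f u - ⟪gradient f u, X k - u⟫ ≤
      f (X 0) - f u - ⟪gradient f u, X 0 - u⟫ - k * h * ε ^ 2 := by
    intro k
    induction k with
    | zero => simp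
    | succ k ih =>
      intro hk
      have h0 := ih (Nat.le_of_succ_le hk)
      have h1 := hcon.trans (hf.antitone_norm_gradient_of_proximal hd hh hX hk)
      have h2 := hf.add_inner_gradient_le (hd (X (k + 1))) (X k)
      have h3 : X k - X (k + 1) = h • gradient f (X (k + 1)) := by rw [← hX k]; abel
      rw [h3, real_inner_smul_right, real_inner_self_eq_norm_sq] at h2
      have h4 : X k - u = (X (k + 1) - u) + h • gradient f (X (k + 1)) := by rw [← hX k]; abel
      rw [h4, inner_add_right, real_inner_smul_right] at h0
      have h5 := real_inner_le_norm (gradient f u) (gradient f (X (k + 1)))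
      have h6 : ε ^ 2 ≤ ‖gradient f (X (k + 1))‖ ^ 2 -
          ⟪gradient f u, gradient f (X (k + 1))⟫ := by
        nlinarith [norm_nonneg (gradient f u), norm_nonneg (gradient f (X (k + 1)))]
      have h7 := mul_le_mul_of_nonneg_left h6 hh.le
      push_cast
      linarith
  have h1 := hf.add_inner_gradient_le (hd u) (X n)
  have h2 := key n le_rfl
  linarith

end ProximalSequence

lemma LocallyLipschitz.exists_lipschitzOnWith_ball {F : Type*} [PseudoMetricSpace F] {φ : E → F}
    (hφ : LocallyLipschitz φ) (c : E) (R : ℝ) : ∃ K, LipschitzOnWith K φ (Metric.ball c R) := by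
  obtain ⟨K, hK⟩ := LocallyLipschitzOn.exists_lipschitzOnWith_of_compact
    (isCompact_closedBall c R) hφ.locallyLipschitzOn
  exact ⟨K, hK.mono Metric.ball_subset_closedBall⟩

lemma LocallyLipschitz.ae_differentiableAt [MeasurableSpace E] [BorelSpace E] {φ : E → E}
    (hφ : LocallyLipschitz φ) : ∀ᵐ z, DifferentiableAt ℝ φ z := by
  have h1 : ∀ n : ℕ, ∀ᵐ z, z ∈ Metric.ball (0 : E) n → DifferentiableAt ℝ φ z := by
    intro n
    obtain ⟨K, hK⟩ := hφ.exists_lipschitzOnWith_ball (0 : E) n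
    filter_upwards [hK.ae_differentiableWithinAt_of_mem (μ := volume)] with z hz hzn
    exact (hz hzn).differentiableAt (Metric.isOpen_ball.mem_nhds hzn)
  filter_upwards [ae_all_iff.2 h1] with z hz
  obtain ⟨n, hn⟩ := exists_nat_gt ‖z‖
  exact hz n (by simpa using hn)

/-- Two convex functions of class `C^{1,1}_loc` with equal gradient norms and the same
Crandall–Pazy direction have the same gradient. -/
theorem ConvexOn.gradient_eq_of_norm_gradient_eq {f g : E → ℝ}
    (hf : ConvexOn ℝ univ f) (hg : ConvexOn ℝ univ g)
    (hfd : Differentiable ℝ f) (hgd : Differentiable ℝ g)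
    (hfl : LocallyLipschitz (gradient f)) (hgl : LocallyLipschitz (gradient g))
    {p : E} (hpf : p ∈ closure (range (gradient f)))
    (hfmin : ∀ q ∈ closure (range (gradient f)), ‖p‖ ≤ ‖q‖)
    (hpg : p ∈ closure (range (gradient g)))
    (hgmin : ∀ q ∈ closure (range (gradient g)), ‖p‖ ≤ ‖q‖)
    (hnorm : ∀ x, ‖gradient f x‖ = ‖gradient g x‖) (x : E) : gradient f x = gradient g x := by
  borelize E
  set D : E → ℝ := fun y => ‖gradient f y - gradient g y‖ ^ 2 with hDdef
  have hDl : LocallyLipschitz D := hfl.norm_sub_sq hgl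
  have hDle : ∀ y, D y ≤ 8 * (‖gradient f y‖ ^ 2 - ‖p‖ ^ 2) := by
    intro y
    have h1 := hf.norm_gradient_sub_sq_le hfd hpf hfmin y
    have h2 := hg.norm_gradient_sub_sq_le hgd hpg hgmin y
    rw [← hnorm] at h2
    have h3 : ‖gradient f y - gradient g y‖ ≤ ‖gradient f y - p‖ + ‖gradient g y - p‖ := by
      rw [← sub_sub_sub_cancel_right _ _ p]
      exact norm_sub_le _ _
    have h4 := pow_le_pow_left₀ (norm_nonneg _) h3 2
    have h5 := sq_nonneg (‖gradient f y - p‖ - ‖gradient g y - p‖)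
    simp only [hDdef]
    nlinarith
  have hae : ∀ᵐ z, DifferentiableAt ℝ D z ∧ fderiv ℝ D z (gradient f z) ≤ 0 := by
    filter_upwards [hfl.ae_differentiableAt, hgl.ae_differentiableAt] with z hz1 hz2
    exact ⟨(hz1.sub hz2).norm_sq ℝ,
      fderiv_norm_sub_gradient_sq_apply_le_zero hg hfd hgd hnorm hz1 hz2⟩
  have hε : ∀ ε : ℝ, 0 < ε → D x ≤ 8 * ((‖p‖ + 2 * ε) ^ 2 - ‖p‖ ^ 2) := by
    intro ε hε
    obtain ⟨u, hu⟩ := Metric.mem_closure_range_iff.1 hpf ε hε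
    have hu' : ‖gradient f u‖ < ‖p‖ + ε := by
      rw [dist_comm, dist_eq_norm] at hu
      linarith [norm_sub_norm_le (gradient f u) p]
    set Φ := f x - f u - ⟪gradient f u, x - u⟫ with hΦ
    have hΦ0 : 0 ≤ Φ := by linarith [hf.add_inner_gradient_le (hfd u) x]
    set T := Φ / ε ^ 2 + 1 with hT
    have hT0 : 0 < T := by positivity
    have hTΦ : Φ < T * ε ^ 2 := by
      rw [hT, add_mul, div_mul_cancel₀ _ (by positivity)]
      linarith [pow_pos hε 2]
    set R := T * ‖gradient f x‖ + 1 with hR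
    obtain ⟨L, hL⟩ := hDl.exists_lipschitzOnWith_ball x R
    obtain ⟨K, hK⟩ := hfl.exists_lipschitzOnWith_ball x R
    have hbound : ∀ n : ℕ, D x ≤ 8 * ((‖p‖ + 2 * ε) ^ 2 - ‖p‖ ^ 2) +
        L * K * ‖gradient f x‖ * T ^ 2 * (1 / ((n : ℝ) + 1)) := by
      intro m
      obtain ⟨n, hn⟩ : ∃ n, n = m + 1 := ⟨_, rfl⟩
      have hn0 : (0 : ℝ) < n := by rw [hn]; positivity
      set h := T / n with hh
      have hh0 : 0 < h := by positivity
      have hnh : n * h = T := mul_div_cancel₀ _ hn0.ne'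
      choose J hJ using hf.exists_add_smul_gradient_eq hfd hh0
      set X : ℕ → E := fun k => J^[k] x with hXdef
      have hX0 : X 0 = x := rfl
      have hX : ∀ k, X (k + 1) + h • gradient f (X (k + 1)) = X k := by
        intro k
        simp only [hXdef, Function.iterate_succ_apply']
        exact hJ _
      have hball : ∀ k ≤ n, X k ∈ Metric.ball x R := by
        intro k hk
        have h1 := hf.norm_proximal_sub_le hfd hh0 hX k
        rw [mem_ball_iff_norm, ← hX0]
        have h2 : (k : ℝ) * h ≤ T := by
          rw [← hnh]
          gcongr
        have h3 := mul_le_mul_of_nonneg_right h2 (norm_nonneg (gradient f (X 0)))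
        rw [hR, ← hX0]
        linarith
      have hstep : ∀ k ≤ n, D x ≤ D (X k) + k * (L * K * ‖gradient f x‖ * h ^ 2) := by
        intro k
        induction k with
        | zero => simp [hX0]
        | succ k ih =>
          intro hk
          have h1 := hL.le_add_of_ae_fderiv_apply_le_zero hK (hae.mono fun z hz _ => hz) hh0.le
            (hball _ hk) (by rw [hX]; exact hball _ (Nat.le_of_succ_le hk))
          rw [hX] at h1
          have h2 := hf.antitone_norm_gradient_of_proximal hfd hh0 hX (Nat.zero_le (k + 1))
          simp only [hX0] at h2
          have h3 : (L : ℝ) * K * ‖gradient f (X (k + 1))‖ * h ^ 2 ≤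
              L * K * ‖gradient f x‖ * h ^ 2 := by gcongr
          have h4 := ih (Nat.le_of_succ_le hk)
          push_cast
          linarith
      have hlast := hf.norm_gradient_proximal_lt hfd hh0 hX u hε (n := n) (by
        rw [hX0, hnh]; exact hTΦ)
      have h1 := hstep n le_rfl
      have h2 := hDle (X n)
      have h3 : ‖gradient f (X n)‖ ^ 2 ≤ (‖p‖ + 2 * ε) ^ 2 :=
        pow_le_pow_left₀ (norm_nonneg _) (by linarith) 2
      have h4 : n * (L * K * ‖gradient f x‖ * h ^ 2) =
          L * K * ‖gradient f x‖ * T ^ 2 * (1 / ((m : ℝ) + 1)) := by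
        have : (m : ℝ) + 1 = n := by rw [hn]; push_cast; rfl
        rw [this, hh]
        field_simp
      linarith
    have hlim : Tendsto (fun n : ℕ => 8 * ((‖p‖ + 2 * ε) ^ 2 - ‖p‖ ^ 2) +
        L * K * ‖gradient f x‖ * T ^ 2 * (1 / ((n : ℝ) + 1))) atTop
        (𝓝 (8 * ((‖p‖ + 2 * ε) ^ 2 - ‖p‖ ^ 2) + L * K * ‖gradient f x‖ * T ^ 2 * 0)) :=
      (tendsto_one_div_add_atTop_nhds_zero_nat.const_mul _).const_add _
    simpa using ge_of_tendsto' hlim hbound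
  have hlim : Tendsto (fun ε : ℝ => 8 * ((‖p‖ + 2 * ε) ^ 2 - ‖p‖ ^ 2)) (𝓝[>] 0)
      (𝓝 (8 * ((‖p‖ + 2 * 0) ^ 2 - ‖p‖ ^ 2))) :=
    ((by fun_prop : Continuous fun ε : ℝ => 8 * ((‖p‖ + 2 * ε) ^ 2 - ‖p‖ ^ 2)).tendsto 0).mono_left
      nhdsWithin_le_nhds
  have hD0 : D x ≤ 0 := by
    have := ge_of_tendsto hlim (eventually_mem_nhdsWithin.mono hε)
    simpa using this
  have : ‖gradient f x - gradient g x‖ = 0 := pow_eq_zero_iff two_ne_zero |>.1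
    (le_antisymm hD0 (by positivity))
  exact sub_eq_zero.1 (norm_eq_zero.1 this)

end FiniteDimensional

/-- **Determination of convex `C^{1,1}_loc` functions on `ℝ^d`.**
If `f, g : ℝ^d → ℝ` are convex, differentiable with locally Lipschitz gradients,
have equal gradient norms everywhere, and have the same Crandall–Pazy direction
(the element of minimal norm of the closure of the range of the gradient),
then `f` and `g` differ by an additive constant. -/
theorem determination_C11loc_euclidean
    (d : ℕ)
    (f g : EuclideanSpace ℝ (Fin d) → ℝ)
    (hfconv : ConvexOn ℝ Set.univ f) (hgconv : ConvexOn ℝ Set.univ g)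
    (hfdiff : ∀ x, DifferentiableAt ℝ f x) (hgdiff : ∀ x, DifferentiableAt ℝ g x)
    (hflip : LocallyLipschitz (gradient f)) (hglip : LocallyLipschitz (gradient g))
    (pf pg : EuclideanSpace ℝ (Fin d))
    (hpf : pf ∈ closure (Set.range (gradient f)) ∧
      ∀ q ∈ closure (Set.range (gradient f)), ‖pf‖ ≤ ‖q‖)
    (hpg : pg ∈ closure (Set.range (gradient g)) ∧
      ∀ q ∈ closure (Set.range (gradient g)), ‖pg‖ ≤ ‖q‖)
    (hnorm : ∀ x, ‖gradient f x‖ = ‖gradient g x‖)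
    (hp : pf = pg) :
    ∃ c : ℝ, ∀ x, f x = g x + c := by
  subst hp
  refine ⟨f 0 - g 0, fun x => ?_⟩
  have hgrad := hfconv.gradient_eq_of_norm_gradient_eq hgconv hfdiff hgdiff hflip hglip
    hpf.1 hpf.2 hpg.1 hpg.2 hnorm
  have hfderiv : ∀ y, fderiv ℝ (fun z => f z - g z) y = 0 := by
    intro y
    rw [fderiv_fun_sub (hfdiff y) (hgdiff y), ← toDual_gradient, ← toDual_gradient, hgrad, sub_self]
  have := is_const_of_fderiv_eq_zero (fun y => (hfdiff y).sub (hgdiff y)) hfderiv x 0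
  simp only [Pi.sub_apply] at this
  linarith
end

section
/- Let H be a real Hilbert space, f : H → ℝ ∪ {+∞} a proper lower semicontinuous convex function, x a point of the closure of the effective domain of f, and γ : [0, +∞) → H the subgradient curve of f emanating from x. Then the map t ↦ ‖∂°f(γ(t))‖ is nonincreasing on (0, +∞), and ‖∂°f(γ(t))‖ converges, as t → +∞, to inf_{y ∈ H} s_f(y), the infimum of the slope of f over H. -/
open Set Filter MeasureTheory RealInnerProductSpace
open scoped ENNReal NNReal Classical

variable {H : Type*} [NormedAddCommGroup H] [InnerProductSpace ℝ H] [CompleteSpace H]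

/-- The convex subdifferential of an extended-real-valued function `f` at `x`. -/
def SubdiffE (f : H → EReal) (x : H) : Set H :=
  {p | ∀ y, f x + ((⟪p, y - x⟫ : ℝ) : EReal) ≤ f y}

/-- Convexity for extended-real-valued functions. -/
def ConvexE (f : H → EReal) : Prop :=
  ∀ x y : H, ∀ a b : ℝ, 0 ≤ a → 0 ≤ b → a + b = 1 →
    f (a • x + b • y) ≤ (a : EReal) * f x + (b : EReal) * f y

/-- The element of minimal norm of a set (defined when it exists, `0` otherwise).
For a nonempty closed convex subset of a Hilbert space this is the projection of `0`. -/
noncomputable def minNormElt (S : Set H) : H :=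
  if h : ∃ p ∈ S, ∀ q ∈ S, ‖p‖ ≤ ‖q‖ then h.choose else 0

/-- The slope of `f` at `x`: `dist(0, ∂f(x))`, with value `⊤` when `∂f(x) = ∅`. -/
noncomputable def slopeE (f : H → EReal) (x : H) : ℝ≥0∞ :=
  ⨅ p ∈ SubdiffE f x, (‖p‖₊ : ℝ≥0∞)

/-- `γ : [0,∞) → H` is the subgradient curve of `f` emanating from `x`:
a locally absolutely continuous curve with `γ 0 = x` and `γ' t ∈ -∂f(γ t)` a.e. -/
def IsSubgradientCurve (f : H → EReal) (x : H) (γ : ℝ → H) : Prop :=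
  γ 0 = x ∧ ContinuousOn γ (Set.Ici 0) ∧
  ∃ v : ℝ → H,
    (∀ t > 0, MeasureTheory.IntegrableOn v (Set.Ioc 0 t)) ∧
    (∀ t ≥ 0, γ t = x + ∫ s in Set.Ioc 0 t, v s) ∧
    (∀ᵐ t ∂(MeasureTheory.volume.restrict (Set.Ioi (0:ℝ))), -v t ∈ SubdiffE f (γ t))

open scoped Topology

theorem AbsolutelyContinuousOnInterval.of_dist_le {X Y : Type*} [PseudoMetricSpace X]
    [PseudoMetricSpace Y] {g : ℝ → X} {k : ℝ → Y} {a b : ℝ}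
    (hk : AbsolutelyContinuousOnInterval k a b)
    (h : ∀ s ∈ uIcc a b, ∀ t ∈ uIcc a b, dist (g s) (g t) ≤ dist (k s) (k t)) :
    AbsolutelyContinuousOnInterval g a b := by
  refine squeeze_zero' (Eventually.of_forall fun E => Finset.sum_nonneg fun i _ => dist_nonneg)
    ?_ hk
  filter_upwards [mem_inf_of_right (mem_principal_self _)] with E hE
  exact Finset.sum_le_sum fun i hi => h _ (hE.1 i hi).1 _ (hE.1 i hi).2

theorem AbsolutelyContinuousOnInterval.of_sub_eq_integral {E : Type*} [NormedAddCommGroup E]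
    [NormedSpace ℝ E] {u w : ℝ → E} {a b : ℝ} (hab : a ≤ b)
    (hw : IntervalIntegrable w volume a b)
    (h : ∀ s t, a ≤ s → s ≤ t → t ≤ b → u t - u s = ∫ r in s..t, w r) :
    AbsolutelyContinuousOnInterval u a b := by
  have hk : AbsolutelyContinuousOnInterval (fun t => ∫ r in a..t, ‖w r‖) a b :=
    hw.norm.absolutelyContinuousOnInterval_intervalIntegral left_mem_uIcc
  refine hk.of_dist_le ?_
  have key : ∀ s t, a ≤ s → s ≤ t → t ≤ b →
      dist (u s) (u t) ≤ dist (∫ r in a..s, ‖w r‖) (∫ r in a..t, ‖w r‖) := by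
    intro s t has hst htb
    have hmono : ∀ c, a ≤ c → c ≤ b → IntervalIntegrable (fun r => ‖w r‖) volume a c := by
      intro c hac hcb
      refine hw.norm.mono_set ?_
      rw [uIcc_of_le hac, uIcc_of_le hab]
      exact Icc_subset_Icc_right hcb
    rw [dist_comm, dist_eq_norm, h s t has hst htb, dist_comm, Real.dist_eq,
      intervalIntegral.integral_interval_sub_left (hmono t (has.trans hst) htb)
        (hmono s has (hst.trans htb))]
    exact (intervalIntegral.norm_integral_le_integral_norm hst).trans (le_abs_self _)
  intro s hs t ht
  rw [uIcc_of_le hab] at hs ht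
  rcases le_total s t with hst | hst
  · exact key s t hs.1 hst ht.2
  · rw [dist_comm, dist_comm (∫ r in a..s, ‖w r‖)]
    exact key t s ht.1 hst hs.2

theorem AbsolutelyContinuousOnInterval.sub_le_of_ae_deriv_le {g : ℝ → ℝ} {a b c : ℝ}
    (hab : a ≤ b) (hg : AbsolutelyContinuousOnInterval g a b)
    (h : ∀ᵐ t, t ∈ Ioo a b → ∀ d, HasDerivAt g d t → d ≤ c) :
    g b - g a ≤ c * (b - a) := by
  rw [← hg.integral_deriv_eq_sub]
  calc ∫ t in a..b, deriv g t ≤ ∫ _ in a..b, c := by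
        refine intervalIntegral.integral_mono_ae_restrict hab hg.intervalIntegrable_deriv
          intervalIntegrable_const ?_
        rw [EventuallyLE, ← restrict_Ioo_eq_restrict_Icc, ae_restrict_iff' measurableSet_Ioo]
        filter_upwards [h, hg.ae_differentiableAt] with t ht hd hmem
        refine ht hmem _ (hd ?_).hasDerivAt
        rw [uIcc_of_le hab]
        exact Ioo_subset_Icc_self hmem
    _ = c * (b - a) := by simp [mul_comm]

theorem Real.abs_sqrt_sq_add_sub_le (x y e : ℝ) :
    |√(x ^ 2 + e ^ 2) - √(y ^ 2 + e ^ 2)| ≤ |x - y| := by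
  have key : ∀ x y : ℝ, √(x ^ 2 + e ^ 2) ≤ √(y ^ 2 + e ^ 2) + |x - y| := by
    intro x y
    refine Real.sqrt_le_iff.2 ⟨by positivity, ?_⟩
    have h1 : |y| ≤ √(y ^ 2 + e ^ 2) := Real.abs_le_sqrt (by nlinarith [sq_nonneg e])
    have h2 := Real.sq_sqrt (show 0 ≤ y ^ 2 + e ^ 2 by positivity)
    have h3 : y * (x - y) ≤ |y| * |x - y| := by
      rw [← abs_mul]; exact le_abs_self _
    have h4 := mul_le_mul_of_nonneg_right h1 (abs_nonneg (x - y))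
    nlinarith [sq_abs (x - y)]
  have h1 := key x y
  have h2 := key y x
  rw [abs_sub_comm y x] at h2
  rw [abs_le]
  constructor <;> linarith

section

variable {E : Type*} [NormedAddCommGroup E] [InnerProductSpace ℝ E]

theorem AbsolutelyContinuousOnInterval.norm_le_of_ae_inner_deriv_le {u w : ℝ → E} {a b c : ℝ}
    (hab : a ≤ b) (hc : 0 ≤ c) (hu : AbsolutelyContinuousOnInterval u a b)
    (h : ∀ᵐ t, t ∈ Ioo a b → HasDerivAt u (w t) t ∧ ⟪w t, u t⟫ ≤ c * ‖u t‖) :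
    ‖u b‖ ≤ ‖u a‖ + c * (b - a) := by
  refine le_of_forall_pos_le_add fun e he => ?_
  have hN : AbsolutelyContinuousOnInterval (fun t => √(‖u t‖ ^ 2 + e ^ 2)) a b := by
    refine hu.of_dist_le fun s _ t _ => ?_
    rw [Real.dist_eq, dist_eq_norm]
    exact (Real.abs_sqrt_sq_add_sub_le _ _ _).trans (abs_norm_sub_norm_le _ _)
  have hle := hN.sub_le_of_ae_deriv_le (c := c) hab (by
    filter_upwards [h] with t ht hmem d hd
    obtain ⟨h1, h2⟩ := ht hmem
    have hpos : 0 < ‖u t‖ ^ 2 + e ^ 2 := by positivity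
    have h3 := (h1.norm_sq.add_const (e ^ 2)).sqrt hpos.ne'
    rw [hd.unique h3, div_le_iff₀ (by positivity), real_inner_comm]
    have h4 : ‖u t‖ ≤ √(‖u t‖ ^ 2 + e ^ 2) :=
      Real.le_sqrt_of_sq_le (by nlinarith [sq_nonneg e])
    nlinarith [mul_le_mul_of_nonneg_left h4 hc])
  have h5 : ‖u b‖ ≤ √(‖u b‖ ^ 2 + e ^ 2) := Real.le_sqrt_of_sq_le (by nlinarith [sq_nonneg e])
  have h6 : √(‖u a‖ ^ 2 + e ^ 2) ≤ ‖u a‖ + e :=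
    Real.sqrt_le_iff.2 ⟨by positivity, by nlinarith [norm_nonneg (u a)]⟩
  linarith

theorem HasDerivAt.norm_le_of_norm_add_sub_le {u : ℝ → E} {u' : E} {t c : ℝ}
    (hu : HasDerivAt u u' t) (h : ∀ d > 0, ‖u (t + d) - u t‖ ≤ d * c) : ‖u'‖ ≤ c := by
  have h1 := (hasDerivAt_iff_tendsto_slope_zero.1 hu).mono_left
    (nhdsWithin_mono 0 (show Ioi (0 : ℝ) ⊆ {0}ᶜ from fun x hx => (ne_of_gt hx)))
  refine le_of_tendsto h1.norm ?_
  filter_upwards [self_mem_nhdsWithin] with d hd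
  rw [norm_smul, norm_inv, Real.norm_of_nonneg (le_of_lt hd), inv_mul_le_iff₀ hd]
  exact h d hd

theorem SubdiffE.ne_top {f : E → EReal} (hproper : ∃ y, f y ≠ ⊤) {z p : E}
    (hp : p ∈ SubdiffE f z) : f z ≠ ⊤ := by
  intro h
  obtain ⟨y, hy⟩ := hproper
  have := hp y
  rw [h, EReal.top_add_coe, top_le_iff] at this
  exact hy this

theorem SubdiffE.toReal_le {f : E → EReal} (hproper : ∃ y, f y ≠ ⊤) (hnobot : ∀ y, f y ≠ ⊥)
    {z p y : E} (hp : p ∈ SubdiffE f z) (hy : f y ≠ ⊤) :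
    (f z).toReal + ⟪p, y - z⟫ ≤ (f y).toReal := by
  have h := hp y
  rw [← EReal.coe_toReal (SubdiffE.ne_top hproper hp) (hnobot z),
    ← EReal.coe_toReal hy (hnobot y)] at h
  exact_mod_cast h

theorem SubdiffE.inner_sub_nonneg {f : E → EReal} (hproper : ∃ y, f y ≠ ⊤)
    (hnobot : ∀ y, f y ≠ ⊥) {y z p q : E} (hp : p ∈ SubdiffE f y) (hq : q ∈ SubdiffE f z) :
    0 ≤ ⟪p - q, y - z⟫ := by
  have h1 := SubdiffE.toReal_le hproper hnobot hp (SubdiffE.ne_top hproper hq)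
  have h2 := SubdiffE.toReal_le hproper hnobot hq (SubdiffE.ne_top hproper hp)
  rw [← neg_sub y z, inner_neg_right] at h1
  rw [inner_sub_left]
  linarith

theorem SubdiffE.mem_of_tendsto {ι : Type*} {l : Filter ι} [l.NeBot] {f : E → EReal}
    (hnobot : ∀ y, f y ≠ ⊥) (hlsc : LowerSemicontinuous f) {z p : ι → E} {z₀ q : E} {M : ℝ}
    (hz : Tendsto z l (𝓝 z₀)) (hp : ∀ y, Tendsto (fun i => ⟪p i, y⟫) l (𝓝 ⟪q, y⟫))
    (hM : ∀ᶠ i in l, ‖p i‖ ≤ M) (h : ∀ᶠ i in l, p i ∈ SubdiffE f (z i)) :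
    q ∈ SubdiffE f z₀ := by
  intro y
  have hlim : Tendsto (fun i => ⟪p i, y - z i⟫) l (𝓝 ⟪q, y - z₀⟫) := by
    have h0 : Tendsto (fun i => ⟪p i, z i - z₀⟫) l (𝓝 0) := by
      have hn : Tendsto (fun i => M * ‖z i - z₀‖) l (𝓝 0) := by
        simpa using (tendsto_iff_norm_sub_tendsto_zero.1 hz).const_mul M
      refine squeeze_zero_norm' ?_ hn
      filter_upwards [hM] with i hi
      exact (norm_inner_le_norm _ _).trans (mul_le_mul_of_nonneg_right hi (norm_nonneg _))
    have h1 := (hp (y - z₀)).sub h0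
    rw [sub_zero] at h1
    refine h1.congr fun i => ?_
    rw [← inner_sub_right]
    congr 1
    abel
  by_cases hy : f y = ⊤
  · rw [hy]; exact le_top
  rw [← EReal.coe_toReal hy (hnobot y), ← EReal.le_sub_iff_add_le (by simp) (by simp)]
  refine EReal.ge_of_forall_gt_iff_ge.1 fun c hc => ?_
  rw [← EReal.coe_sub, EReal.coe_le_coe_iff, le_sub_comm]
  refine le_of_tendsto hlim ?_
  filter_upwards [h, hz.eventually (hlsc z₀ c hc)] with i hi hci
  have h1 := (add_le_add_left hci.le _).trans (hi y)
  rw [← EReal.coe_toReal hy (hnobot y)] at h1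
  norm_cast at h1
  linarith

theorem convex_subdiffE {f : E → EReal} (hproper : ∃ y, f y ≠ ⊤) (hnobot : ∀ y, f y ≠ ⊥)
    (z : E) : Convex ℝ (SubdiffE f z) := by
  intro p hp q hq a b ha hb hab y
  by_cases hy : f y = ⊤
  · rw [hy]; exact le_top
  have h1 := SubdiffE.toReal_le hproper hnobot hp hy
  have h2 := SubdiffE.toReal_le hproper hnobot hq hy
  rw [← EReal.coe_toReal hy (hnobot y),
    ← EReal.coe_toReal (SubdiffE.ne_top hproper hp) (hnobot z)]
  norm_cast
  rw [inner_add_left, real_inner_smul_left, real_inner_smul_left]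
  obtain rfl : b = 1 - a := by linarith
  nlinarith [mul_le_mul_of_nonneg_left h1 ha, mul_le_mul_of_nonneg_left h2 hb]

theorem isClosed_subdiffE {f : E → EReal} (hnobot : ∀ y, f y ≠ ⊥)
    (hlsc : LowerSemicontinuous f) (z : E) : IsClosed (SubdiffE f z) := by
  refine IsSeqClosed.isClosed fun p q hp hq => ?_
  refine SubdiffE.mem_of_tendsto (l := atTop) (p := p) (M := ‖q‖ + 1) hnobot hlsc
    (tendsto_const_nhds (x := z)) (fun y => hq.inner tendsto_const_nhds) ?_
    (Eventually.of_forall hp)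
  filter_upwards [hq.norm.eventually (gt_mem_nhds (lt_add_one ‖q‖))] with i hi using hi.le

end

theorem Ultrafilter.exists_tendsto_inner_of_norm_le {ι : Type*} (U : Ultrafilter ι) {p : ι → H}
    {M : ℝ} (hp : ∀ᶠ i in (U : Filter ι), ‖p i‖ ≤ M) :
    ∃ q : H, ‖q‖ ≤ M ∧ ∀ y, Tendsto (fun i => ⟪p i, y⟫) U (𝓝 ⟪q, y⟫) := by
  let Φ : ι → WeakDual ℝ H := fun i => StrongDual.toWeakDual (InnerProductSpace.toDual ℝ H (p i))
  have hK := WeakDual.isCompact_closedBall (𝕜 := ℝ) (0 : StrongDual ℝ H) M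
  have hmem : ((U.map Φ : Ultrafilter _) : Filter _) ≤
      𝓟 (WeakDual.toStrongDual ⁻¹' Metric.closedBall (0 : StrongDual ℝ H) M) := by
    rw [le_principal_iff, Ultrafilter.coe_map, Filter.mem_map]
    filter_upwards [hp] with i hi
    simpa [Φ] using hi
  obtain ⟨φ, hφ, hlim⟩ := hK.ultrafilter_le_nhds _ hmem
  refine ⟨(InnerProductSpace.toDual ℝ H).symm (WeakDual.toStrongDual φ), ?_, fun y => ?_⟩
  · simpa using hφ
  · have h1 : Tendsto Φ U (𝓝 φ) := hlim
    have h2 := ((WeakDual.eval_continuous (𝕜 := ℝ) (E := H) y).tendsto φ).comp h1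
    rw [InnerProductSpace.toDual_symm_apply]
    exact h2

theorem minNormElt_spec {S : Set H} (hne : S.Nonempty) (hcl : IsClosed S) (hconv : Convex ℝ S) :
    minNormElt S ∈ S ∧ ∀ q ∈ S, ‖minNormElt S‖ ≤ ‖q‖ := by
  have h : ∃ p ∈ S, ∀ q ∈ S, ‖p‖ ≤ ‖q‖ := by
    obtain ⟨p, hp, hmin⟩ := exists_norm_eq_iInf_of_complete_convex hne hcl.isComplete hconv 0
    refine ⟨p, hp, fun q hq => ?_⟩
    have h1 : ⨅ w : S, ‖(0 : H) - w‖ ≤ ‖(0 : H) - q‖ :=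
      ciInf_le ⟨0, by rintro _ ⟨w, rfl⟩; exact norm_nonneg _⟩ (⟨q, hq⟩ : S)
    rw [← hmin] at h1
    simpa using h1
  unfold minNormElt
  rw [dif_pos h]
  exact h.choose_spec

/-- A curve on `(0, ∞)` with integrable derivative `v` such that `-v` selects the
subdifferential of `f` along the curve almost everywhere. -/
structure IsSubgradientFlow (f : H → EReal) (γ v : ℝ → H) : Prop where
  intervalIntegrable : ∀ s t, 0 ≤ s → s ≤ t → IntervalIntegrable v volume s t
  sub_eq_integral : ∀ s t, 0 ≤ s → s ≤ t → γ t - γ s = ∫ r in s..t, v r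
  ae_hasDerivAt_mem : ∀ᵐ t, 0 < t → HasDerivAt γ (v t) t ∧ -v t ∈ SubdiffE f (γ t)

theorem IsSubgradientCurve.exists_flow {f : H → EReal} {x : H} {γ : ℝ → H}
    (hγ : IsSubgradientCurve f x γ) : ∃ v, IsSubgradientFlow f γ v := by
  obtain ⟨-, -, v, hint, hrep, hsub⟩ := hγ
  have hii : ∀ s t, 0 ≤ s → s ≤ t → IntervalIntegrable v volume s t := by
    intro s t hs hst
    rw [intervalIntegrable_iff_integrableOn_Ioc_of_le hst]
    exact (hint (t + 1) (by linarith)).mono_set (Ioc_subset_Ioc hs (by linarith))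
  have hrep' : ∀ t ≥ 0, γ t = x + ∫ r in (0 : ℝ)..t, v r := fun t ht => by
    rw [hrep t ht, intervalIntegral.integral_of_le ht]
  refine ⟨v, hii, fun s t hs hst => ?_, ?_⟩
  · rw [hrep' s hs, hrep' t (hs.trans hst), add_sub_add_left_eq_sub]
    exact intervalIntegral.integral_interval_sub_left (hii 0 t le_rfl (hs.trans hst))
      (hii 0 s le_rfl hs)
  · have hderiv : ∀ᵐ t, ∀ n : ℕ, t ∈ uIcc (0 : ℝ) n →
        HasDerivAt (fun τ => ∫ r in (0 : ℝ)..τ, v r) (v t) t := by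
      rw [ae_all_iff]
      intro n
      filter_upwards [(hii 0 n le_rfl n.cast_nonneg).ae_hasDerivAt_integral] with t ht hmem
      exact ht hmem 0 left_mem_uIcc
    rw [ae_restrict_iff' measurableSet_Ioi] at hsub
    filter_upwards [hsub, hderiv] with t h1 h2 ht
    refine ⟨?_, h1 ht⟩
    obtain ⟨n, hn⟩ := exists_nat_ge t
    have h3 := h2 n (by rw [uIcc_of_le n.cast_nonneg]; exact ⟨ht.le, hn⟩)
    refine (h3.const_add x).congr_of_eventuallyEq ?_
    filter_upwards [lt_mem_nhds ht] with τ hτ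
    exact hrep' τ hτ.le

namespace IsSubgradientFlow

section

variable {E : Type*} [NormedAddCommGroup E] [InnerProductSpace ℝ E] {f : E → EReal}
  {γ v : ℝ → E}

theorem absolutelyContinuousOnInterval_comp_add (hv : IsSubgradientFlow f γ v) {a b d : ℝ}
    (hab : a ≤ b) (had : 0 ≤ a + d) :
    AbsolutelyContinuousOnInterval (fun t => γ (t + d)) a b := by
  refine .of_sub_eq_integral (w := fun t => v (t + d)) hab ?_ fun s t hs hst _ => ?_
  · simpa using (hv.intervalIntegrable (a + d) (b + d) had (by linarith)).comp_add_right d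
  · rw [intervalIntegral.integral_comp_add_right]
    exact hv.sub_eq_integral _ _ (by linarith) (by linarith)

theorem continuousOn (hv : IsSubgradientFlow f γ v) : ContinuousOn γ (Ici 0) := by
  intro t ht
  have h : ContinuousOn (fun t => γ (t + 0)) (uIcc 0 (t + 1)) :=
    (hv.absolutelyContinuousOnInterval_comp_add (by linarith [mem_Ici.1 ht])
      (by simp)).continuousOn
  simp only [add_zero] at h
  rw [uIcc_of_le (by linarith [mem_Ici.1 ht])] at h
  refine (h t ⟨ht, by linarith⟩).mono_of_mem_nhdsWithin ?_
  rw [← Ici_inter_Iic]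
  exact inter_mem_nhdsWithin _ (Iic_mem_nhds (by linarith))

theorem norm_shift_sub_le (hproper : ∃ y, f y ≠ ⊤) (hnobot : ∀ y, f y ≠ ⊥)
    (hv : IsSubgradientFlow f γ v) {s t d : ℝ} (hs : 0 < s) (hst : s ≤ t) (hd : 0 ≤ d) :
    ‖γ (t + d) - γ t‖ ≤ ‖γ (s + d) - γ s‖ := by
  have hac : AbsolutelyContinuousOnInterval (fun τ => γ (τ + d) - γ (τ + 0)) s t :=
    (hv.absolutelyContinuousOnInterval_comp_add hst (by linarith)).fun_sub
      (hv.absolutelyContinuousOnInterval_comp_add hst (by linarith))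
  simp only [add_zero] at hac
  have hshift := (measurePreserving_add_right volume d).quasiMeasurePreserving.ae
    hv.ae_hasDerivAt_mem
  have h := hac.norm_le_of_ae_inner_deriv_le (w := fun τ => v (τ + d) - v τ) (c := 0) hst le_rfl
    (by
      filter_upwards [hv.ae_hasDerivAt_mem, hshift] with τ h1 h2 hτ
      obtain ⟨h3, h4⟩ := h1 (hs.trans hτ.1)
      obtain ⟨h5, h6⟩ := h2 (by linarith [hτ.1])
      refine ⟨(h5.comp_add_const τ d).sub h3, ?_⟩
      have h7 := SubdiffE.inner_sub_nonneg hproper hnobot h6 h4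
      rw [← neg_sub_neg, ← neg_sub, inner_neg_left]
      linarith)
  simpa using h

theorem norm_add_sub_le (hproper : ∃ y, f y ≠ ⊤) (hnobot : ∀ y, f y ≠ ⊥)
    (hv : IsSubgradientFlow f γ v) {s d : ℝ} {p : E} (hs : 0 < s) (hd : 0 ≤ d)
    (hp : p ∈ SubdiffE f (γ s)) : ‖γ (s + d) - γ s‖ ≤ d * ‖p‖ := by
  have hac : AbsolutelyContinuousOnInterval (fun τ => γ (τ + 0) - γ s) s (s + d) := by
    refine (hv.absolutelyContinuousOnInterval_comp_add (d := 0) (by linarith)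
      (by linarith)).of_dist_le fun a _ b _ => ?_
    rw [dist_sub_right]
  simp only [add_zero] at hac
  have h := hac.norm_le_of_ae_inner_deriv_le (w := v) (c := ‖p‖) (by linarith) (norm_nonneg p)
    (by
      filter_upwards [hv.ae_hasDerivAt_mem] with τ h1 hτ
      obtain ⟨h3, h4⟩ := h1 (hs.trans hτ.1)
      refine ⟨h3.sub_const _, ?_⟩
      have h5 := SubdiffE.inner_sub_nonneg hproper hnobot h4 hp
      rw [inner_sub_left, inner_neg_left] at h5
      have h6 := (abs_le.1 (abs_real_inner_le_norm p (γ τ - γ s))).1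
      linarith)
  simpa [mul_comm] using h

theorem ae_norm_le (hproper : ∃ y, f y ≠ ⊤) (hnobot : ∀ y, f y ≠ ⊥)
    (hv : IsSubgradientFlow f γ v) {s : ℝ} {p : E} (hs : 0 < s)
    (hp : p ∈ SubdiffE f (γ s)) :
    ∀ᵐ t, s ≤ t → ‖v t‖ ≤ ‖p‖ := by
  filter_upwards [hv.ae_hasDerivAt_mem] with t ht hst
  exact (ht (hs.trans_le hst)).1.norm_le_of_norm_add_sub_le fun d hd =>
    (hv.norm_shift_sub_le hproper hnobot hs hst (le_of_lt hd)).trans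
      (hv.norm_add_sub_le hproper hnobot hs (le_of_lt hd) hp)

end

variable {f : H → EReal} {γ v : ℝ → H}

theorem exists_mem_norm_le (hproper : ∃ y, f y ≠ ⊤) (hnobot : ∀ y, f y ≠ ⊥)
    (hlsc : LowerSemicontinuous f) (hv : IsSubgradientFlow f γ v) {s t : ℝ} {p : H}
    (hs : 0 < s) (hst : s ≤ t) (hp : p ∈ SubdiffE f (γ s)) :
    ∃ q ∈ SubdiffE f (γ t), ‖q‖ ≤ ‖p‖ := by
  have hae : ∀ᵐ τ, s ≤ τ → ‖-v τ‖ ≤ ‖p‖ ∧ -v τ ∈ SubdiffE f (γ τ) := by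
    filter_upwards [hv.ae_norm_le hproper hnobot hs hp, hv.ae_hasDerivAt_mem] with τ h1 h2 hτ
    exact ⟨by rw [norm_neg]; exact h1 hτ, (h2 (hs.trans_le hτ)).2⟩
  have hfr : ∃ᶠ τ in 𝓝[>] t, s ≤ τ → ‖-v τ‖ ≤ ‖p‖ ∧ -v τ ∈ SubdiffE f (γ τ) := by
    rw [(nhdsGT_basis t).frequently_iff]
    intro b hb
    by_contra! hcon
    have h0 : volume (Ioo t b) = 0 := by
      refine measure_mono_null (fun τ hτ => ?_) hae
      have := hcon τ hτ
      simp only [mem_compl_iff, mem_ofPred_eq]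
      grind
    rw [Real.volume_Ioo, ENNReal.ofReal_eq_zero] at h0
    linarith
  let l := 𝓝[>] t ⊓ 𝓟 {τ | s ≤ τ → ‖-v τ‖ ≤ ‖p‖ ∧ -v τ ∈ SubdiffE f (γ τ)}
  have hne : l.NeBot := frequently_mem_iff_neBot.1 hfr
  let U := Ultrafilter.of l
  have hUl : (U : Filter ℝ) ≤ l := Ultrafilter.of_le l
  have hgt : ∀ᶠ τ in (U : Filter ℝ), t < τ :=
    (hUl.trans inf_le_left) self_mem_nhdsWithin
  have hgood : ∀ᶠ τ in (U : Filter ℝ), ‖-v τ‖ ≤ ‖p‖ ∧ -v τ ∈ SubdiffE f (γ τ) := by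
    filter_upwards [hgt, (hUl.trans inf_le_right) (mem_principal_self _)] with τ h1 h2
    exact h2 (hst.trans h1.le)
  have hlim : Tendsto γ U (𝓝 (γ t)) :=
    ((hv.continuousOn.continuousAt (Ici_mem_nhds (hs.trans_le hst))).tendsto).mono_left
      ((hUl.trans inf_le_left).trans nhdsWithin_le_nhds)
  obtain ⟨q, hq, hw⟩ := U.exists_tendsto_inner_of_norm_le (hgood.mono fun _ h => h.1)
  exact ⟨q, SubdiffE.mem_of_tendsto hnobot hlsc hlim hw (hgood.mono fun _ h => h.1)
    (hgood.mono fun _ h => h.2), hq⟩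

theorem nonempty_subdiffE (hproper : ∃ y, f y ≠ ⊤) (hnobot : ∀ y, f y ≠ ⊥)
    (hlsc : LowerSemicontinuous f) (hv : IsSubgradientFlow f γ v) {t : ℝ} (ht : 0 < t) :
    (SubdiffE f (γ t)).Nonempty := by
  have h : ∃ s ∈ Ioo 0 t, -v s ∈ SubdiffE f (γ s) := by
    by_contra! hcon
    have h0 : volume (Ioo 0 t) = 0 := by
      refine measure_mono_null (fun τ hτ => ?_) hv.ae_hasDerivAt_mem
      have := hcon τ hτ
      simp only [mem_compl_iff, mem_ofPred_eq]
      grind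
    rw [Real.volume_Ioo, ENNReal.ofReal_eq_zero] at h0
    linarith
  obtain ⟨s, hs, hmem⟩ := h
  obtain ⟨q, hq, -⟩ := hv.exists_mem_norm_le hproper hnobot hlsc hs.1 hs.2.le hmem
  exact ⟨q, hq⟩

theorem exists_lipschitzOnWith_sub_inner (hproper : ∃ y, f y ≠ ⊤) (hnobot : ∀ y, f y ≠ ⊥)
    (hlsc : LowerSemicontinuous f) (hv : IsSubgradientFlow f γ v) {s : ℝ} (hs : 0 < s) (p : H) :
    ∃ K : ℝ≥0, LipschitzOnWith K (fun t => (f (γ t)).toReal - ⟪p, γ t⟫) (Ici s) := by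
  obtain ⟨q₀, hq₀⟩ := hv.nonempty_subdiffE hproper hnobot hlsc hs
  have hγ : ∀ a b, s ≤ a → a ≤ b → ‖γ b - γ a‖ ≤ (b - a) * ‖q₀‖ := by
    intro a b ha hab
    obtain ⟨q, hq, hle⟩ := hv.exists_mem_norm_le hproper hnobot hlsc hs ha hq₀
    have h := hv.norm_add_sub_le hproper hnobot (hs.trans_le ha) (sub_nonneg.2 hab) hq
    rw [add_sub_cancel] at h
    exact h.trans (mul_le_mul_of_nonneg_left hle (sub_nonneg.2 hab))
  have hdist : ∀ a b, s ≤ a → s ≤ b → ‖γ b - γ a‖ ≤ ‖q₀‖ * |a - b| := by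
    intro a b ha hb
    rcases le_total a b with hab | hab
    · rw [abs_sub_comm, abs_of_nonneg (sub_nonneg.2 hab), mul_comm]
      exact hγ a b ha hab
    · rw [abs_of_nonneg (sub_nonneg.2 hab), mul_comm, norm_sub_rev]
      exact hγ b a hb hab
  have key : ∀ a b, s ≤ a → s ≤ b → (f (γ a)).toReal - (f (γ b)).toReal ≤
      ‖q₀‖ * (‖q₀‖ * |a - b|) := by
    intro a b ha hb
    obtain ⟨q, hq, hle⟩ := hv.exists_mem_norm_le hproper hnobot hlsc hs ha hq₀
    obtain ⟨r, hr⟩ := hv.nonempty_subdiffE hproper hnobot hlsc (hs.trans_le hb)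
    have h1 := SubdiffE.toReal_le hproper hnobot hq (SubdiffE.ne_top hproper hr)
    have h2 := (abs_le.1 (abs_real_inner_le_norm q (γ b - γ a))).1
    have h3 := mul_le_mul hle (hdist a b ha hb) (norm_nonneg _) (norm_nonneg _)
    linarith
  refine ⟨(‖q₀‖₊ + ‖p‖₊) * ‖q₀‖₊, LipschitzOnWith.of_dist_le_mul fun a ha b hb => ?_⟩
  have h1 := key a b ha hb
  have h2 := key b a hb ha
  rw [abs_sub_comm b a] at h2
  have h3 := (abs_real_inner_le_norm p (γ b - γ a)).trans
    (mul_le_mul_of_nonneg_left (hdist a b ha hb) (norm_nonneg p))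
  rw [inner_sub_right] at h3
  obtain ⟨h4, h5⟩ := abs_le.1 h3
  rw [Real.dist_eq, Real.dist_eq, abs_le]
  push_cast
  constructor <;> linarith

theorem exists_mem_norm_lt (hproper : ∃ y, f y ≠ ⊤) (hnobot : ∀ y, f y ≠ ⊥)
    (hlsc : LowerSemicontinuous f) (hv : IsSubgradientFlow f γ v) {y p : H} {L : ℝ}
    (hp : p ∈ SubdiffE f y) (hL : ‖p‖ < L) :
    ∃ t > 0, ∃ q ∈ SubdiffE f (γ t), ‖q‖ < L := by
  by_contra! hcon
  obtain ⟨K, hK⟩ := hv.exists_lipschitzOnWith_sub_inner hproper hnobot hlsc one_pos p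
  set ψ : ℝ → ℝ := fun t => (f (γ t)).toReal - ⟪p, γ t⟫ with hψ
  set c := L * (L - ‖p‖) with hc
  have hcpos : 0 < c := mul_pos ((norm_nonneg p).trans_lt hL) (sub_pos.2 hL)
  have hfin : ∀ t > 0, f (γ t) ≠ ⊤ := fun t ht =>
    SubdiffE.ne_top hproper (hv.nonempty_subdiffE hproper hnobot hlsc ht).choose_spec
  have hlow : ∀ t > 0, (f y).toReal - ⟪p, y⟫ ≤ ψ t := by
    intro t ht
    have h := SubdiffE.toReal_le hproper hnobot hp (hfin t ht)
    rw [inner_sub_right] at h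
    simp only [hψ]
    linarith
  have hdec : ∀ b, 1 ≤ b → ψ b - ψ 1 ≤ -c * (b - 1) := by
    intro b hb
    have hac : AbsolutelyContinuousOnInterval ψ 1 b :=
      (hK.mono (by rw [uIcc_of_le hb]; exact Icc_subset_Ici_self)).absolutelyContinuousOnInterval
    refine hac.sub_le_of_ae_deriv_le hb ?_
    filter_upwards [hv.ae_hasDerivAt_mem] with t h1 ht d hd
    have ht0 : 0 < t := one_pos.trans ht.1
    obtain ⟨h2, h3⟩ := h1 ht0
    have hmin : IsLocalMin (fun τ => ψ τ + ⟪v t + p, γ τ⟫) t := by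
      filter_upwards [lt_mem_nhds ht0] with τ hτ
      have h4 := SubdiffE.toReal_le hproper hnobot h3 (hfin τ hτ)
      rw [inner_neg_left, inner_sub_right] at h4
      simp only [hψ, inner_add_left]
      linarith
    have h5 : HasDerivAt (fun τ => ⟪v t + p, γ τ⟫) ⟪v t + p, v t⟫ t := by
      simpa using (hasDerivAt_const t (v t + p)).inner ℝ h2
    have h6 := hmin.hasDerivAt_eq_zero (hd.add h5)
    rw [inner_add_left, real_inner_self_eq_norm_sq] at h6
    have h7 : L ≤ ‖v t‖ := by simpa using hcon t ht0 _ h3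
    have h8 := (abs_le.1 (abs_real_inner_le_norm p (v t))).1
    have h9 : L * (L - ‖p‖) ≤ ‖v t‖ * (‖v t‖ - ‖p‖) :=
      mul_le_mul h7 (by linarith) (by linarith) (norm_nonneg _)
    nlinarith
  obtain ⟨n, hn⟩ := exists_nat_gt ((ψ 1 - ((f y).toReal - ⟪p, y⟫)) / c)
  rw [div_lt_iff₀ hcpos] at hn
  have hn0 : (0 : ℝ) ≤ n := n.cast_nonneg
  have h1 := hdec (n + 1) (by linarith)
  have h2 := hlow (n + 1) (by linarith)
  nlinarith

end IsSubgradientFlow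

/-- **Monotonicity and convergence of the minimal-norm subgradient along the flow.**
For a proper lsc convex `f : H → ℝ ∪ {+∞}` and the subgradient curve `γ` emanating from
a point `x` of the closure of `dom f`, the map `t ↦ ‖∂°f(γ t)‖` is nonincreasing on
`(0, ∞)` and converges, as `t → ∞`, to `inf_H s_f`, the infimum of the slope of `f`. -/
theorem slope_nonincreasing_and_tendsto_inf_along_flow
    (f : H → EReal)
    (hproper : ∃ y, f y ≠ ⊤) (hnobot : ∀ y, f y ≠ ⊥)
    (hlsc : LowerSemicontinuous f) (hconv : ConvexE f)
    (x : H) (hx : x ∈ closure {y | f y ≠ ⊤})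
    (γ : ℝ → H) (hγ : IsSubgradientCurve f x γ) :
    AntitoneOn (fun t => ‖minNormElt (SubdiffE f (γ t))‖) (Set.Ioi (0:ℝ)) ∧
    Filter.Tendsto (fun t => (‖minNormElt (SubdiffE f (γ t))‖₊ : ℝ≥0∞))
      Filter.atTop (nhds (⨅ y, slopeE f y)) := by
  obtain ⟨v, hv⟩ := hγ.exists_flow
  have hspec : ∀ t > 0, minNormElt (SubdiffE f (γ t)) ∈ SubdiffE f (γ t) ∧
      ∀ q ∈ SubdiffE f (γ t), ‖minNormElt (SubdiffE f (γ t))‖ ≤ ‖q‖ := fun t ht =>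
    minNormElt_spec (hv.nonempty_subdiffE hproper hnobot hlsc ht)
      (isClosed_subdiffE hnobot hlsc _) (convex_subdiffE hproper hnobot _)
  have hanti : AntitoneOn (fun t => ‖minNormElt (SubdiffE f (γ t))‖) (Set.Ioi (0:ℝ)) := by
    intro s hs t ht hst
    obtain ⟨q, hq, hle⟩ := hv.exists_mem_norm_le hproper hnobot hlsc hs hst (hspec s hs).1
    exact ((hspec t ht).2 q hq).trans hle
  refine ⟨hanti, tendsto_order.2 ⟨fun a ha => ?_, fun a ha => ?_⟩⟩
  · filter_upwards [eventually_gt_atTop 0] with t ht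
    exact ha.trans_le ((iInf_le _ (γ t)).trans (iInf₂_le _ (hspec t ht).1))
  · simp only [slopeE, iInf_lt_iff] at ha
    obtain ⟨y, p, hp, hpa⟩ := ha
    obtain ⟨L, hpL, hLa⟩ := ENNReal.lt_iff_exists_nnreal_btwn.1 hpa
    obtain ⟨t₀, ht₀, q, hq, hqL⟩ := hv.exists_mem_norm_lt (L := L) hproper hnobot hlsc hp
      (by exact_mod_cast hpL)
    filter_upwards [eventually_ge_atTop t₀] with t ht
    refine lt_of_le_of_lt ?_ hLa
    have h := (hanti ht₀ (ht₀.trans_le ht) ht).trans (((hspec t₀ ht₀).2 q hq).trans hqL.le)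
    exact_mod_cast h
end
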